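/- arXiv:1405.1517 — 5 statements merged into one kernel-verified Lean document; each statement's English description precedes it below -/
import Mathlib

section
/- Let T be a self-adjoint operator in a separable complex Hilbert space H with T^{-1} ∈ B(H), and let S be a closed operator in H with dom(S) ∩ dom(S*) ⊇ dom(T). Then: (i) the operators T^{-1}ST and T^{-1}S*T are well-defined on dom(T^2), hence densely defined in H; and (ii) the adjoint relations (T^{-1}ST)* = TS*T^{-1} and (T^{-1}S*T)* = TST^{-1} hold; in particular TS*T^{-1} and TST^{-1} are closed operators in H. -/
noncomputable section

open scoped ENNReal InnerProductSpace

namespace OpInterp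

section Mcomp

variable {R E F G : Type*} [CommRing R] [AddCommGroup E] [Module R E]
  [AddCommGroup F] [Module R F] [AddCommGroup G] [Module R G]

/-- The maximal domain of the composition `g ∘ f` of two partial linear maps. -/
def mcompDomain (g : F →ₗ.[R] G) (f : E →ₗ.[R] F) : Submodule R E where
  carrier := {x | ∃ hx : x ∈ f.domain, f ⟨x, hx⟩ ∈ g.domain}
  zero_mem' := ⟨f.domain.zero_mem, by
    have h0 : (⟨(0 : E), f.domain.zero_mem⟩ : f.domain) = 0 := rfl
    rw [h0, f.map_zero]; exact g.domain.zero_mem⟩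
  add_mem' := by
    rintro x y ⟨hx, hfx⟩ ⟨hy, hfy⟩
    refine ⟨f.domain.add_mem hx hy, ?_⟩
    have h : (⟨x + y, f.domain.add_mem hx hy⟩ : f.domain) = ⟨x, hx⟩ + ⟨y, hy⟩ := rfl
    rw [h, f.map_add]
    exact g.domain.add_mem hfx hfy
  smul_mem' := by
    rintro c x ⟨hx, hfx⟩
    refine ⟨f.domain.smul_mem c hx, ?_⟩
    have h : (⟨c • x, f.domain.smul_mem c hx⟩ : f.domain) = c • (⟨x, hx⟩ : f.domain) := rfl
    rw [h, f.map_smul]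
    exact g.domain.smul_mem c hfx

theorem mem_mcompDomain {g : F →ₗ.[R] G} {f : E →ₗ.[R] F} {x : E} :
    x ∈ mcompDomain g f ↔ ∃ hx : x ∈ f.domain, f ⟨x, hx⟩ ∈ g.domain := Iff.rfl

/-- The inclusion of the maximal composition domain into the domain of `f`. -/
def mcompIncl (g : F →ₗ.[R] G) (f : E →ₗ.[R] F) : mcompDomain g f →ₗ[R] f.domain where
  toFun x := ⟨(x : E), x.2.choose⟩
  map_add' x y := Subtype.ext rfl
  map_smul' c x := Subtype.ext rfl

theorem mcompIncl_mem (g : F →ₗ.[R] G) (f : E →ₗ.[R] F) (x : mcompDomain g f) :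
    f (mcompIncl g f x) ∈ g.domain := by
  exact x.2.choose_spec

/-- The maximally defined composition of two partial linear maps: its domain consists of
all `x ∈ dom f` with `f x ∈ dom g`. -/
def mcomp (g : F →ₗ.[R] G) (f : E →ₗ.[R] F) : E →ₗ.[R] G where
  domain := mcompDomain g f
  toFun := g.toFun.comp ((f.toFun.comp (mcompIncl g f)).codRestrict g.domain
    fun x => mcompIncl_mem g f x)

theorem mcomp_domain (g : F →ₗ.[R] G) (f : E →ₗ.[R] F) :
    (mcomp g f).domain = mcompDomain g f := rfl

end Mcomp

section Hilbert

variable {E F G : Type*} [NormedAddCommGroup E] [InnerProductSpace ℂ E]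
  [NormedAddCommGroup F] [InnerProductSpace ℂ F]
  [NormedAddCommGroup G] [InnerProductSpace ℂ G]

/-- `B ∈ B(F,E)` is the (everywhere defined, bounded) inverse of the partial linear
map `T`; this encodes the hypothesis `T⁻¹ ∈ B(H)`. -/
def IsBoundedInverse (T : E →ₗ.[ℂ] F) (B : F →L[ℂ] E) : Prop :=
  (∀ x : T.domain, B (T x) = x) ∧ ∀ y : F, ∃ hy : B y ∈ T.domain, T ⟨B y, hy⟩ = y

/-- `C = S ∘ B` holds, where the bounded operator `B` maps into the domain of `S`;
this encodes hypotheses such as `S T⁻¹ ∈ B(H)` with `B = T⁻¹` and `C = S T⁻¹`. -/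
def IsComposition (S : E →ₗ.[ℂ] F) (B : G →L[ℂ] E) (C : G →L[ℂ] F) : Prop :=
  ∀ y : G, ∃ hy : B y ∈ S.domain, S ⟨B y, hy⟩ = C y

/-- The bounded operator `B` extends the partial linear map `Y`.  If `Y` is densely
defined this says precisely that `Y` is closable with bounded closure `B` (on all of `H`). -/
def ExtendsTo (Y : E →ₗ.[ℂ] F) (B : E →L[ℂ] F) : Prop :=
  ∀ x : Y.domain, Y x = B x

/-- The partial linear map `Y` is bounded on its domain. -/
def IsBddPMap (Y : E →ₗ.[ℂ] F) : Prop :=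
  ∃ c : ℝ, ∀ x : Y.domain, ‖Y x‖ ≤ c * ‖(x : E)‖

/-- `Y ∈ B(H)`: the partial linear map `Y` is everywhere defined and given by the
bounded operator `B`. -/
def IsBoundedOp (Y : E →ₗ.[ℂ] F) (B : E →L[ℂ] F) : Prop :=
  Y.domain = ⊤ ∧ ExtendsTo Y B

/-- Nonnegativity (`T ≥ 0`) of a partial linear map on a complex Hilbert space. -/
def IsNonnegPMap (T : E →ₗ.[ℂ] E) : Prop :=
  ∀ x : T.domain, 0 ≤ (⟪(x : E), T x⟫_ℂ).re ∧ (⟪(x : E), T x⟫_ℂ).im = 0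

/-- The `n`-th approximation number of a bounded operator; for operators between Hilbert
spaces these are exactly the singular values `s_{n+1}(A)`. -/
def approxNumber (A : E →L[ℂ] F) (n : ℕ) : ℝ :=
  sInf {c : ℝ | ∃ B : E →L[ℂ] F, Module.finrank ℂ (LinearMap.range (B : E →ₗ[ℂ] F)) ≤ n ∧
    ‖A - B‖ = c}

/-- The Schatten–von Neumann `p`-norm `‖A‖_{B_p}` (`= (∑ s_n(A)^p)^{1/p}`), valued in
`[0,∞]`; for `p = ∞` it is the operator norm. -/
def schattenNorm (p : ℝ≥0∞) (A : E →L[ℂ] F) : ℝ≥0∞ :=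
  if p = ∞ then (‖A‖₊ : ℝ≥0∞)
  else (∑' n : ℕ, ENNReal.ofReal (approxNumber A n) ^ p.toReal) ^ (1 / p.toReal)

/-- Membership in the Schatten–von Neumann ideal `B_p`. -/
def MemSchatten (p : ℝ≥0∞) (A : E →L[ℂ] F) : Prop :=
  schattenNorm p A ≠ ∞

end Hilbert

/-- The open strip `Σ = {z : 0 < Re z < 1}`. -/
def strip : Set ℂ := {z : ℂ | z.re ∈ Set.Ioo (0 : ℝ) 1}

/-- The closed strip `Σ̄ = {z : 0 ≤ Re z ≤ 1}`. -/
def closedStrip : Set ℂ := {z : ℂ | z.re ∈ Set.Icc (0 : ℝ) 1}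

end OpInterp
section Structures

variable {E F : Type*} [NormedAddCommGroup E] [InnerProductSpace ℂ E] [CompleteSpace E]
  [NormedAddCommGroup F] [InnerProductSpace ℂ F] [CompleteSpace F]

namespace OpInterp

/-- `Q` is the family of real powers `α ↦ R^α` of the nonnegative self-adjoint operator `R`,
as provided by the spectral theorem (these properties characterize it uniquely). -/
structure IsRealPowerFamily (R : E →ₗ.[ℂ] E) (Q : ℝ → E →ₗ.[ℂ] E) : Prop where
  zero : Q 0 = (LinearMap.id : E →ₗ[ℂ] E).toPMap ⊤
  one : Q 1 = R
  selfAdjoint : ∀ a : ℝ, 0 ≤ a → IsSelfAdjoint (Q a)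
  nonneg : ∀ a : ℝ, 0 ≤ a → IsNonnegPMap (Q a)
  semigroup : ∀ a b : ℝ, 0 ≤ a → 0 ≤ b → mcomp (Q a) (Q b) = Q (a + b)
  domain_antitone : ∀ a b : ℝ, 0 ≤ a → a ≤ b → (Q b).domain ≤ (Q a).domain

/-- `P` is the family `z ↦ T^{-z}` (`Re z ≥ 0`) of complex powers of the boundedly
invertible self-adjoint operator `T`, defined by the spectral theorem of `T` via the branch
`λ^z = λ^{Re z} e^{i Im z ln|λ|}[θ(λ) + e^{-π Im z}θ(-λ)]`. -/
structure IsSpectralInvPowers (T : E →ₗ.[ℂ] E) (Tinv : E →L[ℂ] E)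
    (P : ℂ → E →L[ℂ] E) : Prop where
  zero : P 0 = 1
  one : P 1 = Tinv
  semigroup : ∀ z w : ℂ, 0 ≤ z.re → 0 ≤ w.re → P (z + w) = P z ∘L P w
  /-- `‖T^{iy}‖ ≤ max (1, e^{-π y})`, i.e. `‖P (i s)‖ = ‖T^{-i s}‖ ≤ max (1, e^{π s})`. -/
  norm_imaginary : ∀ s : ℝ, ‖P (Complex.I * s)‖ ≤ max 1 (Real.exp (Real.pi * s))
  norm_le : ∀ z : ℂ, z.re ∈ Set.Icc (0 : ℝ) 1 →
    ‖P z‖ ≤ max 1 ‖Tinv‖ * max 1 (Real.exp (Real.pi * |z.im|))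
  /-- if `T ≥ 0` then the imaginary powers are unitary. -/
  isometry_imaginary_of_nonneg : IsNonnegPMap T → ∀ (s : ℝ) (x : E),
    ‖P (Complex.I * s) x‖ = ‖x‖
  strong_continuous : ∀ x : E, ContinuousOn (fun z => P z x) {z : ℂ | 0 ≤ z.re}
  analytic : ∀ x : E, DifferentiableOn ℂ (fun z => P z x) {z : ℂ | 0 < z.re}
  mapsTo_domain : ∀ z : ℂ, 0 ≤ z.re → ∀ x : E, x ∈ T.domain → P z x ∈ T.domain
  commutes : ∀ z : ℂ, 0 ≤ z.re → ∀ x : T.domain,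
    ∀ hx : P z (x : E) ∈ T.domain, T ⟨P z (x : E), hx⟩ = P z (T x)

/-- `R = |S| = (S^*S)^{1/2}`, the modulus of the densely defined closed operator `S`
(these properties characterize `|S|` uniquely). -/
structure IsModulus (S : E →ₗ.[ℂ] F) (R : E →ₗ.[ℂ] E) : Prop where
  selfAdjoint : IsSelfAdjoint R
  nonneg : IsNonnegPMap R
  domain_eq : R.domain = S.domain
  norm_eq : ∀ (x : R.domain) (hx : (x : E) ∈ S.domain), ‖R x‖ = ‖S ⟨(x : E), hx⟩‖

/-- `U = U_S`, the partial isometry in the polar decomposition `S = U_S |S|`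
(with `R = |S|` and initial space `cl (ran |S|)`). -/
structure IsPolarPartialIsometry (S : E →ₗ.[ℂ] F) (R : E →ₗ.[ℂ] E) (U : E →L[ℂ] F) :
    Prop where
  map_eq : ∀ (x : S.domain) (hx : (x : E) ∈ R.domain), U (R ⟨(x : E), hx⟩) = S x
  norm_map : ∀ x : R.domain, ‖U (R x)‖ = ‖R x‖
  ker_perp : ∀ y : E, (∀ x : R.domain, ⟪R x, y⟫_ℂ = 0) → U y = 0

/-- The open sector `S_ω` with vertex `0`, opening half-angle `ω`, along the positive
real axis; `S_0 = (0,∞)`. -/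
def sector (ω : ℝ) : Set ℂ :=
  if ω = 0 then {z : ℂ | z ≠ 0 ∧ Complex.arg z = 0}
  else {z : ℂ | z ≠ 0 ∧ |Complex.arg z| < ω}

/-- `R = (T - ζ)⁻¹ ∈ B(H)`, i.e. `ζ` belongs to the resolvent set of `T` with
resolvent `R`. -/
def IsResolventAt (T : E →ₗ.[ℂ] E) (ζ : ℂ) (R : E →L[ℂ] E) : Prop :=
  (∀ x : T.domain, R (T x - ζ • (x : E)) = x) ∧
    ∀ y : E, ∃ hy : R y ∈ T.domain, T ⟨R y, hy⟩ - ζ • R y = y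

/-- The resolvent set of the partial linear map `T`. -/
def presolventSet (T : E →ₗ.[ℂ] E) : Set ℂ :=
  {ζ : ℂ | ∃ R : E →L[ℂ] E, IsResolventAt T ζ R}

/-- The spectrum of the partial linear map `T`. -/
def pspectrum (T : E →ₗ.[ℂ] E) : Set ℂ := (presolventSet T)ᶜ

/-- `T` is a (densely defined, closed) sectorial operator of angle `ω ∈ [0,π)`. -/
structure IsSectorial (T : E →ₗ.[ℂ] E) (ω : ℝ) : Prop where
  denseDomain : Dense (T.domain : Set E)
  isClosed : T.IsClosed
  angle_mem : ω ∈ Set.Ico (0 : ℝ) Real.pi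
  spectrum_subset : pspectrum T ⊆ closure (sector ω)
  resolvent_bound : ∀ ω' ∈ Set.Ioo ω Real.pi, ∃ M : ℝ,
    ∀ ζ ∉ closure (sector ω'), ∀ R : E →L[ℂ] E, IsResolventAt T ζ R → ‖ζ • R‖ ≤ M

/-- `P` is the family `z ↦ T^{-z}` (`Re z ≥ 0`) of fractional powers of the sectorial
operator `T` (defined via the Dunford integral for `Re z > 0` and by strong limits on the
boundary), with bounded imaginary powers: `T ∈ BIP(N,θ)`,
`‖T^{is}‖ = ‖P (-is)‖ ≤ N e^{θ|s|}`. -/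
structure IsBIPInvPowers (T : E →ₗ.[ℂ] E) (Tinv : E →L[ℂ] E) (N θ : ℝ)
    (P : ℂ → E →L[ℂ] E) : Prop where
  zero : P 0 = 1
  one : P 1 = Tinv
  semigroup : ∀ z w : ℂ, 0 ≤ z.re → 0 ≤ w.re → P (z + w) = P z ∘L P w
  bip : ∀ s : ℝ, ‖P (Complex.I * s)‖ ≤ N * Real.exp (θ * |s|)
  strong_continuous : ∀ x : E, ContinuousOn (fun z => P z x) {z : ℂ | 0 ≤ z.re}
  analytic : ∀ x : E, DifferentiableOn ℂ (fun z => P z x) {z : ℂ | 0 < z.re}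
  mapsTo_domain : ∀ z : ℂ, 0 ≤ z.re → ∀ x : E, x ∈ T.domain → P z x ∈ T.domain
  commutes : ∀ z : ℂ, 0 ≤ z.re → ∀ x : T.domain,
    ∀ hx : P z (x : E) ∈ T.domain, T ⟨P z (x : E), hx⟩ = P z (T x)

end OpInterp

end Structures

namespace OpInterp

section MaximalComposition

variable {R E F G : Type*} [CommRing R] [AddCommGroup E] [Module R E]
  [AddCommGroup F] [Module R F] [AddCommGroup G] [Module R G]

theorem mcomp_domain_mono {g₁ g₂ : F →ₗ.[R] G} (h : g₁.domain ≤ g₂.domain) (f : E →ₗ.[R] F) :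
    (mcomp g₁ f).domain ≤ (mcomp g₂ f).domain :=
  fun _ ⟨hx, hfx⟩ => ⟨hx, h hfx⟩

end MaximalComposition

section AdjointComposition

variable {H : Type*} [NormedAddCommGroup H] [InnerProductSpace ℂ H]
  {T A B : H →ₗ.[ℂ] H} {Tinv : H →L[ℂ] H}

theorem IsBoundedInverse.inner_left (h : IsBoundedInverse T Tinv) (hT : T.IsFormalAdjoint T)
    (a b : H) : ⟪Tinv a, b⟫_ℂ = ⟪a, Tinv b⟫_ℂ := by
  obtain ⟨ha, hTa⟩ := h.2 a
  obtain ⟨hb, hTb⟩ := h.2 b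
  have := hT ⟨_, ha⟩ ⟨_, hb⟩
  rw [hTa, hTb] at this
  exact this.symm

theorem IsBoundedInverse.dense_mcomp_self_domain (h : IsBoundedInverse T Tinv)
    (hT : Dense (T.domain : Set H)) : Dense ((mcomp T T).domain : Set H) := by
  have hr : DenseRange Tinv := hT.mono fun x hx => ⟨T ⟨x, hx⟩, h.1 ⟨x, hx⟩⟩
  refine (hr.comp hr Tinv.continuous).mono ?_
  rintro _ ⟨y, rfl⟩
  obtain ⟨hy, hTy⟩ := h.2 (Tinv y)
  refine ⟨hy, ?_⟩
  change T ⟨Tinv (Tinv y), hy⟩ ∈ T.domain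
  rw [hTy]
  exact (h.2 y).1

theorem IsBoundedInverse.dense_mcomp_domain (h : IsBoundedInverse T Tinv)
    (hT : Dense (T.domain : Set H)) (hA : T.domain ≤ A.domain) :
    Dense ((mcomp A T).domain : Set H) :=
  (h.dense_mcomp_self_domain hT).mono (mcomp_domain_mono hA T)

/-- If `A` and `B` are formal adjoints of each other whose domains contain `dom T`, then
`(T⁻¹AT)* = TBT⁻¹`. -/
theorem IsBoundedInverse.adjoint_conj [CompleteSpace H] (h : IsBoundedInverse T Tinv)
    (hT : IsSelfAdjoint T) (hAB : A.IsFormalAdjoint B)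
    (hA : T.domain ≤ A.domain) (hB : T.domain ≤ B.domain) :
    (LinearMap.compPMap (Tinv : H →ₗ[ℂ] H) (mcomp A T)).adjoint
      = mcomp T (mcomp B ((Tinv : H →ₗ[ℂ] H).toPMap ⊤)) := by
  have hTd := hT.dense_domain
  have hTT : T.IsFormalAdjoint T := by
    have := LinearPMap.adjoint_isFormalAdjoint hTd
    rwa [LinearPMap.isSelfAdjoint_def.mp hT] at this
  have hdense : Dense ((LinearMap.compPMap (Tinv : H →ₗ[ℂ] H) (mcomp A T)).domain : Set H) :=
    h.dense_mcomp_domain hTd hA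
  have hle : mcomp T (mcomp B ((Tinv : H →ₗ[ℂ] H).toPMap ⊤))
      ≤ (LinearMap.compPMap (Tinv : H →ₗ[ℂ] H) (mcomp A T)).adjoint := by
    refine LinearPMap.IsFormalAdjoint.le_adjoint hdense ?_
    rintro ⟨x, hx, hTx⟩ ⟨y, ⟨hy, hBy⟩, hTy⟩
    change ⟪Tinv (A ⟨T ⟨x, hx⟩, hTx⟩), y⟫_ℂ = ⟪x, T ⟨B ⟨Tinv y, hBy⟩, hTy⟩⟫_ℂ
    rw [h.inner_left hTT]
    exact (hAB ⟨_, hTx⟩ ⟨_, hBy⟩).trans (hTT ⟨x, hx⟩ ⟨_, hTy⟩)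
  refine (LinearPMap.eq_of_le_of_domain_eq hle (le_antisymm hle.1 fun y hy => ?_)).symm
  set w := (LinearMap.compPMap (Tinv : H →ₗ[ℂ] H) (mcomp A T)).adjoint ⟨y, hy⟩ with hw
  have hBy : Tinv y ∈ B.domain := hB (h.2 y).1
  have key : B ⟨Tinv y, hBy⟩ = Tinv w := by
    refine (hTd.mono hA).eq_of_inner_right ℂ fun z hz => ?_
    obtain ⟨hz', hTz⟩ := h.2 z
    have hmem : Tinv z ∈ (LinearMap.compPMap (Tinv : H →ₗ[ℂ] H) (mcomp A T)).domain :=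
      ⟨hz', by rw [hTz]; exact hz⟩
    have e := (LinearPMap.adjoint_isFormalAdjoint hdense).symm ⟨_, hmem⟩ ⟨y, hy⟩
    have e' : (LinearMap.compPMap (Tinv : H →ₗ[ℂ] H) (mcomp A T)) ⟨_, hmem⟩
        = Tinv (A ⟨z, hz⟩) := by
      change Tinv (A ⟨T ⟨Tinv z, hz'⟩, _⟩) = _
      simp only [hTz]
    rw [e', ← hw] at e
    rw [← h.inner_left hTT, ← e, h.inner_left hTT]
    exact (hAB ⟨z, hz⟩ ⟨_, hBy⟩).symm
  refine ⟨⟨Submodule.mem_top, hBy⟩, ?_⟩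
  change B ⟨Tinv y, hBy⟩ ∈ T.domain
  rw [key]
  exact (h.2 w).1

end AdjointComposition

end OpInterp

open OpInterp in
/-- Theorem 2.3 (i),(ii). -/
theorem statement1
    {H : Type*} [NormedAddCommGroup H] [InnerProductSpace ℂ H] [CompleteSpace H]
    [TopologicalSpace.SeparableSpace H]
    (T S : H →ₗ.[ℂ] H) (Tinv : H →L[ℂ] H)
    (hT : IsSelfAdjoint T) (hTinv : IsBoundedInverse T Tinv)
    (hS : S.IsClosed) (hdomS : T.domain ≤ S.domain) (hdomS' : T.domain ≤ S.adjoint.domain) :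
    -- (i) well-defined on `dom T²`, hence densely defined:
    (mcomp T T).domain ≤ (LinearMap.compPMap (Tinv : H →ₗ[ℂ] H) (mcomp S T)).domain ∧
    (mcomp T T).domain ≤ (LinearMap.compPMap (Tinv : H →ₗ[ℂ] H) (mcomp S.adjoint T)).domain ∧
    Dense ((LinearMap.compPMap (Tinv : H →ₗ[ℂ] H) (mcomp S T)).domain : Set H) ∧
    Dense ((LinearMap.compPMap (Tinv : H →ₗ[ℂ] H) (mcomp S.adjoint T)).domain : Set H) ∧
    -- (ii) the adjoint relations `(T⁻¹ST)* = TS*T⁻¹`, `(T⁻¹S*T)* = TST⁻¹`: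
    (LinearMap.compPMap (Tinv : H →ₗ[ℂ] H) (mcomp S T)).adjoint
        = mcomp T (mcomp S.adjoint ((Tinv : H →ₗ[ℂ] H).toPMap ⊤)) ∧
    (LinearMap.compPMap (Tinv : H →ₗ[ℂ] H) (mcomp S.adjoint T)).adjoint
        = mcomp T (mcomp S ((Tinv : H →ₗ[ℂ] H).toPMap ⊤)) ∧
    -- hence `TS*T⁻¹` and `TST⁻¹` are closed:
    (mcomp T (mcomp S.adjoint ((Tinv : H →ₗ[ℂ] H).toPMap ⊤))).IsClosed ∧
    (mcomp T (mcomp S ((Tinv : H →ₗ[ℂ] H).toPMap ⊤))).IsClosed := by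
  have hTd := hT.dense_domain
  have hSS : S.adjoint.IsFormalAdjoint S :=
    LinearPMap.adjoint_isFormalAdjoint (hTd.mono hdomS)
  have hdense := hTinv.dense_mcomp_domain hTd hdomS
  have hdense' := hTinv.dense_mcomp_domain hTd hdomS'
  have hadj := hTinv.adjoint_conj hT hSS.symm hdomS hdomS'
  have hadj' := hTinv.adjoint_conj hT hSS hdomS' hdomS
  refine ⟨mcomp_domain_mono hdomS T, mcomp_domain_mono hdomS' T, hdense, hdense', hadj, hadj',
    ?_, ?_⟩
  · rw [← hadj]
    exact LinearPMap.adjoint_isClosed hdense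
  · rw [← hadj']
    exact LinearPMap.adjoint_isClosed hdense'
end
end

section
/- Let T be a self-adjoint operator in a separable complex Hilbert space H with T^{-1} ∈ B(H), and let S be a closed operator in H with dom(S) ∩ dom(S*) ⊇ dom(T). Then T^{-1}ST (defined maximally, with dom(T^{-1}ST) ⊇ dom(T^2)) is a bounded operator if and only if (T^{-1}ST)* = TS*T^{-1} ∈ B(H); and in that case the closure satisfies cl(T^{-1}ST) = (TS*T^{-1})* and ||cl(T^{-1}ST)||_{B(H)} = ||TS*T^{-1}||_{B(H)}. -/
noncomputable section

open scoped ENNReal InnerProductSpace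

namespace OpInterp

section Graphs

variable {R E F G : Type*} [CommRing R] [AddCommGroup E] [Module R E]
  [AddCommGroup F] [Module R F] [AddCommGroup G] [Module R G]

theorem mem_graph_mcomp {g : F →ₗ.[R] G} {f : E →ₗ.[R] F} {x : E} {z : G} :
    (x, z) ∈ (mcomp g f).graph ↔ ∃ y, (x, y) ∈ f.graph ∧ (y, z) ∈ g.graph := by
  simp only [LinearPMap.mem_graph_iff]
  constructor
  · rintro ⟨⟨x, hx⟩, rfl, rfl⟩
    exact ⟨f ⟨x, hx.1⟩, ⟨⟨x, hx.1⟩, rfl, rfl⟩, ⟨f ⟨x, hx.1⟩, hx.2⟩, rfl, rfl⟩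
  · rintro ⟨_, ⟨⟨x, hx⟩, rfl, rfl⟩, ⟨⟨y, hy⟩, rfl, rfl⟩⟩
    exact ⟨⟨x, hx, hy⟩, rfl, rfl⟩

end Graphs

section Bounded

variable {E F : Type*} [NormedAddCommGroup E] [InnerProductSpace ℂ E]
  [NormedAddCommGroup F] [InnerProductSpace ℂ F]

theorem ExtendsTo.eq_toPMap {Y : E →ₗ.[ℂ] F} {B : E →L[ℂ] F} (h : ExtendsTo Y B) :
    Y = (B : E →ₗ[ℂ] F).toPMap Y.domain := by
  refine LinearPMap.ext rfl fun x hx _ => ?_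
  exact h ⟨x, hx⟩

theorem ExtendsTo.isBddPMap {Y : E →ₗ.[ℂ] F} {B : E →L[ℂ] F} (h : ExtendsTo Y B) :
    IsBddPMap Y :=
  ⟨‖B‖, fun x => by rw [h x]; exact B.le_opNorm x⟩

theorem isBoundedOp_iff {Y : E →ₗ.[ℂ] F} {B : E →L[ℂ] F} :
    IsBoundedOp Y B ↔ Y = (B : E →ₗ[ℂ] F).toPMap ⊤ := by
  constructor
  · rintro ⟨hdom, h⟩
    rw [h.eq_toPMap, hdom]
  · rintro rfl
    exact ⟨rfl, fun _ => rfl⟩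

theorem toPMap_top_injective {A B : E →L[ℂ] F}
    (h : (A : E →ₗ[ℂ] F).toPMap ⊤ = (B : E →ₗ[ℂ] F).toPMap ⊤) : A = B := by
  ext x
  exact (LinearPMap.ext_iff.mp h).2 (x := x) (hf := trivial) (hg := trivial)

theorem exists_extendsTo_of_isBddPMap [CompleteSpace F] {Y : E →ₗ.[ℂ] F}
    (hY : Dense (Y.domain : Set E)) (h : IsBddPMap Y) : ∃ B : E →L[ℂ] F, ExtendsTo Y B := by
  obtain ⟨c, hc⟩ := h
  refine ⟨(Y.toFun.mkContinuous c hc).extend Y.domain.subtypeL, fun x => ?_⟩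
  exact ((Y.toFun.mkContinuous c hc).extend_eq (e := Y.domain.subtypeL) hY.denseRange_val
    isUniformEmbedding_subtype_val.isUniformInducing x).symm

theorem isClosed_toPMap_top (B : E →L[ℂ] F) : ((B : E →ₗ[ℂ] F).toPMap ⊤).IsClosed := by
  have h : (((B : E →ₗ[ℂ] F).toPMap ⊤).graph : Set (E × F)) = {p | B p.1 = p.2} := by
    ext ⟨x, y⟩
    simp [LinearPMap.mem_graph_iff]
  rw [LinearPMap.IsClosed, h]
  exact isClosed_eq (by fun_prop) (by fun_prop)

theorem ExtendsTo.closure_eq {Y : E →ₗ.[ℂ] F} {B : E →L[ℂ] F} (h : ExtendsTo Y B)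
    (hY : Dense (Y.domain : Set E)) : Y.closure = (B : E →ₗ[ℂ] F).toPMap ⊤ := by
  have hle : Y ≤ (B : E →ₗ[ℂ] F).toPMap ⊤ := by
    refine ⟨le_top, fun x y hxy => ?_⟩
    rw [h x, hxy]
    rfl
  have hcl := isClosed_toPMap_top B
  have hYc : Y.IsClosable := hcl.isClosable.leIsClosable hle
  apply LinearPMap.eq_of_eq_graph
  rw [← hYc.graph_closure_eq_closure_graph]
  refine le_antisymm
    (Submodule.topologicalClosure_minimal _ (LinearPMap.le_graph_of_le hle) hcl) ?_
  rintro ⟨x, y⟩ hxy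
  obtain ⟨⟨x, -⟩, rfl, rfl⟩ := (LinearPMap.mem_graph_iff _).mp hxy
  have hcont : Continuous fun z : E => (z, B z) := by fun_prop
  refine map_mem_closure (s := (Y.domain : Set E)) hcont (hY x) fun z hz => ?_
  exact (LinearPMap.mem_graph_iff _).mpr ⟨⟨z, hz⟩, rfl, h ⟨z, hz⟩⟩

variable [CompleteSpace E]

theorem mem_graph_adjoint_iff {Y : E →ₗ.[ℂ] F} (hY : Dense (Y.domain : Set E)) {y : F} {w : E} :
    (y, w) ∈ Y.adjoint.graph ↔ ∀ x : Y.domain, ⟪w, x⟫_ℂ = ⟪y, Y x⟫_ℂ := by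
  constructor
  · intro h x
    obtain ⟨v, rfl, rfl⟩ := (LinearPMap.mem_graph_iff _).mp h
    exact LinearPMap.adjoint_isFormalAdjoint hY v x
  · intro h
    exact (LinearPMap.mem_graph_iff _).mpr
      ⟨⟨y, LinearPMap.mem_adjoint_domain_of_exists y ⟨w, h⟩⟩, rfl,
        LinearPMap.adjoint_apply_eq hY _ h⟩

variable [CompleteSpace F]

theorem ExtendsTo.adjoint_eq {Y : E →ₗ.[ℂ] F} {B : E →L[ℂ] F} (h : ExtendsTo Y B)
    (hY : Dense (Y.domain : Set E)) : Y.adjoint = (B.adjoint : F →ₗ[ℂ] E).toPMap ⊤ := by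
  conv_lhs => rw [h.eq_toPMap]
  exact B.toPMap_adjoint_eq_adjoint_toPMap_of_dense hY

theorem extendsTo_of_adjoint_eq {Y : E →ₗ.[ℂ] F} {B : F →L[ℂ] E}
    (hY : Dense (Y.domain : Set E)) (h : Y.adjoint = (B : F →ₗ[ℂ] E).toPMap ⊤) :
    ExtendsTo Y B.adjoint := by
  refine fun x => ext_inner_left ℂ fun y => ?_
  have hy : (y, B y) ∈ Y.adjoint.graph := by
    rw [h]
    exact (LinearPMap.mem_graph_iff _).mpr ⟨⟨y, trivial⟩, rfl, rfl⟩
  rw [ContinuousLinearMap.adjoint_inner_right, (mem_graph_adjoint_iff hY).mp hy x]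

end Bounded

section Inverse

variable {E F : Type*} [NormedAddCommGroup E] [InnerProductSpace ℂ E]
  [NormedAddCommGroup F] [InnerProductSpace ℂ F]

theorem IsBoundedInverse.mem_graph_iff {T : E →ₗ.[ℂ] F} {B : F →L[ℂ] E}
    (h : IsBoundedInverse T B) {x : E} {y : F} : (x, y) ∈ T.graph ↔ B y = x := by
  rw [LinearPMap.mem_graph_iff]
  constructor
  · rintro ⟨z, rfl, rfl⟩
    exact h.1 z
  · rintro rfl
    obtain ⟨hy, hTy⟩ := h.2 y
    exact ⟨⟨B y, hy⟩, rfl, hTy⟩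

theorem IsBoundedInverse.mem_domain_mcomp_iff {G : Type*} [NormedAddCommGroup G]
    [InnerProductSpace ℂ G] {T : E →ₗ.[ℂ] F} {B : F →L[ℂ] E} (h : IsBoundedInverse T B)
    (S : F →ₗ.[ℂ] G) (u : F) : B u ∈ (mcomp S T).domain ↔ u ∈ S.domain := by
  obtain ⟨hu, hTu⟩ := h.2 u
  refine ⟨fun ⟨_, h'⟩ => hTu ▸ h', fun h' => ⟨hu, ?_⟩⟩
  rwa [hTu]

variable [CompleteSpace E]

theorem IsBoundedInverse.inner_left_s2 {T : E →ₗ.[ℂ] E} {B : E →L[ℂ] E}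
    (hT : IsSelfAdjoint T) (h : IsBoundedInverse T B) (x y : E) :
    ⟪B x, y⟫_ℂ = ⟪x, B y⟫_ℂ := by
  obtain ⟨hx, hTx⟩ := h.2 x
  obtain ⟨hy, hTy⟩ := h.2 y
  have hmem : (B x, x) ∈ T.adjoint.graph := by
    rw [LinearPMap.isSelfAdjoint_def.mp hT]
    exact h.mem_graph_iff.mpr rfl
  have key := (mem_graph_adjoint_iff hT.dense_domain).mp hmem ⟨B y, hy⟩
  rw [hTy] at key
  exact key.symm

theorem IsBoundedInverse.dense_domain_mcomp {T : E →ₗ.[ℂ] E} {B : E →L[ℂ] E}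
    (hT : IsSelfAdjoint T) (h : IsBoundedInverse T B) {S : E →ₗ.[ℂ] E}
    (hS : Dense (S.domain : Set E)) : Dense ((mcomp S T).domain : Set E) := by
  have hB : DenseRange B := hT.dense_domain.mono fun x hx => ⟨T ⟨x, hx⟩, h.1 ⟨x, hx⟩⟩
  refine (hB.dense_image B.continuous hS).mono ?_
  rintro _ ⟨u, hu, rfl⟩
  exact (h.mem_domain_mcomp_iff S u).mpr hu

/-- The identity `(T⁻¹ST)* = TS*T⁻¹` holds without any boundedness assumption. -/
theorem IsBoundedInverse.adjoint_conj_eq {T S : E →ₗ.[ℂ] E} {B : E →L[ℂ] E}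
    (hT : IsSelfAdjoint T) (h : IsBoundedInverse T B) (hS : Dense (S.domain : Set E)) :
    (LinearMap.compPMap (B : E →ₗ[ℂ] E) (mcomp S T)).adjoint
      = mcomp T (mcomp S.adjoint ((B : E →ₗ[ℂ] E).toPMap ⊤)) := by
  apply LinearPMap.eq_of_eq_graph
  ext ⟨y, w⟩
  have hdense : Dense ((LinearMap.compPMap (B : E →ₗ[ℂ] E) (mcomp S T)).domain : Set E) :=
    h.dense_domain_mcomp hT hS
  have hR : (y, w) ∈ (mcomp T (mcomp S.adjoint ((B : E →ₗ[ℂ] E).toPMap ⊤))).graph ↔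
      (B y, B w) ∈ S.adjoint.graph := by
    simp only [mem_graph_mcomp, h.mem_graph_iff]
    constructor
    · rintro ⟨_, ⟨_, hy, hS⟩, rfl⟩
      obtain ⟨z, rfl, rfl⟩ := (LinearPMap.mem_graph_iff _).mp hy
      exact hS
    · intro hS
      exact ⟨B w, ⟨B y, (LinearPMap.mem_graph_iff _).mpr ⟨⟨y, trivial⟩, rfl, rfl⟩, hS⟩, rfl⟩
  rw [hR, mem_graph_adjoint_iff hdense, mem_graph_adjoint_iff hS]
  constructor
  · rintro hA ⟨u, hu⟩
    obtain ⟨hBu, hTu⟩ := h.2 u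
    have key : ⟪w, B u⟫_ℂ = ⟪y, B (S ⟨T ⟨B u, hBu⟩, by rwa [hTu]⟩)⟫_ℂ :=
      hA ⟨B u, (h.mem_domain_mcomp_iff S u).mpr hu⟩
    rw [h.inner_left_s2 hT, h.inner_left_s2 hT, key]
    congr 4
  · rintro hA ⟨x, hx, hTx⟩
    have key := hA ⟨T ⟨x, hx⟩, hTx⟩
    rw [h.inner_left_s2 hT, h.inner_left_s2 hT, h.1] at key
    exact key

end Inverse

end OpInterp

open OpInterp in
/-- Theorem 2.3 (iii).  With `T` self-adjoint, `T⁻¹ ∈ B(H)`, `S` closed and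
`dom S ∩ dom S* ⊇ dom T`:  the maximally defined `T⁻¹ST` (whose domain contains `dom T²`)
is bounded iff `(T⁻¹ST)* = TS*T⁻¹ ∈ B(H)`, and in that case
`cl(T⁻¹ST) = (TS*T⁻¹)*` and `‖cl(T⁻¹ST)‖ = ‖TS*T⁻¹‖`. -/
theorem statement2
    {H : Type*} [NormedAddCommGroup H] [InnerProductSpace ℂ H] [CompleteSpace H]
    [TopologicalSpace.SeparableSpace H]
    (T S : H →ₗ.[ℂ] H) (Tinv : H →L[ℂ] H)
    (hT : IsSelfAdjoint T) (hTinv : IsBoundedInverse T Tinv)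
    (hS : S.IsClosed) (hdomS : T.domain ≤ S.domain) (hdomS' : T.domain ≤ S.adjoint.domain) :
    (mcomp T T).domain ≤ (LinearMap.compPMap (Tinv : H →ₗ[ℂ] H) (mcomp S T)).domain ∧
    (IsBddPMap (LinearMap.compPMap (Tinv : H →ₗ[ℂ] H) (mcomp S T)) ↔
      ((LinearMap.compPMap (Tinv : H →ₗ[ℂ] H) (mcomp S T)).adjoint
          = mcomp T (mcomp S.adjoint ((Tinv : H →ₗ[ℂ] H).toPMap ⊤)) ∧
        ∃ B : H →L[ℂ] H,
          IsBoundedOp (mcomp T (mcomp S.adjoint ((Tinv : H →ₗ[ℂ] H).toPMap ⊤))) B)) ∧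
    (IsBddPMap (LinearMap.compPMap (Tinv : H →ₗ[ℂ] H) (mcomp S T)) →
      ((LinearMap.compPMap (Tinv : H →ₗ[ℂ] H) (mcomp S T)).closure
          = (mcomp T (mcomp S.adjoint ((Tinv : H →ₗ[ℂ] H).toPMap ⊤))).adjoint ∧
        ∀ B : H →L[ℂ] H,
          IsBoundedOp (mcomp T (mcomp S.adjoint ((Tinv : H →ₗ[ℂ] H).toPMap ⊤))) B →
          ∀ Bc : H →L[ℂ] H,
            ExtendsTo (LinearMap.compPMap (Tinv : H →ₗ[ℂ] H) (mcomp S T)) Bc →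
            ‖Bc‖ = ‖B‖)) := by
  have hSd : Dense (S.domain : Set H) := hT.dense_domain.mono hdomS
  have hA := hTinv.adjoint_conj_eq hT hSd
  have hAd : Dense ((LinearMap.compPMap (Tinv : H →ₗ[ℂ] H) (mcomp S T)).domain : Set H) :=
    hTinv.dense_domain_mcomp hT hSd
  refine ⟨fun x ⟨hx, hTx⟩ => ⟨hx, hdomS hTx⟩, ⟨fun hb => ⟨hA, ?_⟩, ?_⟩, fun hb => ⟨?_, ?_⟩⟩
  · obtain ⟨C, hC⟩ := exists_extendsTo_of_isBddPMap hAd hb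
    exact ⟨C.adjoint, isBoundedOp_iff.mpr (hA ▸ hC.adjoint_eq hAd)⟩
  · rintro ⟨-, B, hB⟩
    exact (extendsTo_of_adjoint_eq hAd (hA.trans (isBoundedOp_iff.mp hB))).isBddPMap
  · obtain ⟨C, hC⟩ := exists_extendsTo_of_isBddPMap hAd hb
    rw [hC.closure_eq hAd, ← hA, hC.adjoint_eq hAd,
      C.adjoint.toPMap_adjoint_eq_adjoint_toPMap_of_dense (by simp),
      ContinuousLinearMap.adjoint_adjoint]
  · intro B hB Bc hBc
    have h : B = Bc.adjoint := toPMap_top_injective <|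
      (isBoundedOp_iff.mp hB).symm.trans (hA.symm.trans (hBc.adjoint_eq hAd))
    rw [h, LinearIsometryEquiv.norm_map]
end
end

section
/- Let T be a self-adjoint operator in a separable complex Hilbert space H with T^{-1} ∈ B(H), and let S be a closed operator in H with dom(S) ∩ dom(S*) ⊇ dom(T). If TST^{-1} ∈ B(H) and TS*T^{-1} ∈ B(H), then S ∈ B(H) (and hence S* ∈ B(H)), and ||S||_{B(H)} = ||S*||_{B(H)} ≤ e^{2π} · ||TST^{-1}||_{B(H)}^{1/2} · ||TS*T^{-1}||_{B(H)}^{1/2}; moreover, if in addition T ≥ 0, the factor e^{2π} can be replaced by 1. -/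
noncomputable section

open scoped ENNReal InnerProductSpace

namespace OpInterp

/-- If the powers of `r` are dominated along the exponents `2 ^ k` by a constant multiple of
those of `K`, then `r ≤ K`. -/
theorem le_of_pow_two_pow_le_mul_pow {r K c : ℝ} (hK : 0 ≤ K)
    (h : ∀ k : ℕ, r ^ 2 ^ k ≤ c * K ^ 2 ^ k) : r ≤ K := by
  by_contra! hlt
  have hr : 0 < r := hK.trans_lt hlt
  have hq : Filter.Tendsto (fun k : ℕ => c * (K / r) ^ 2 ^ k) Filter.atTop (nhds (c * 0)) :=
    ((tendsto_pow_atTop_nhds_zero_of_lt_one (div_nonneg hK hr.le)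
      ((div_lt_one hr).2 hlt)).comp
      (tendsto_pow_atTop_atTop_of_one_lt (one_lt_two (α := ℕ)))).const_mul c
  have h1 : (1 : ℝ) ≤ c * 0 := by
    refine ge_of_tendsto' hq fun k => ?_
    rw [div_pow, mul_div_assoc', le_div_iff₀ (pow_pos hr _), one_mul]
    exact h k
  linarith

/-- A sequence of nonnegative reals with `a n ^ 2 ≤ a 0 * a (2 * n)` and growth at most
geometric of ratio `K` satisfies `a 1 ≤ K * a 0`. -/
theorem le_mul_of_sq_le_mul_of_le_geometric {a : ℕ → ℝ} {K M : ℝ} (ha : ∀ n, 0 ≤ a n)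
    (hK : 0 ≤ K) (hsq : ∀ n, a n ^ 2 ≤ a 0 * a (2 * n)) (hgeom : ∀ n, a n ≤ M * K ^ n) :
    a 1 ≤ K * a 0 := by
  rcases (ha 0).eq_or_lt with h0 | h0
  · have h1 := hsq 1
    rw [← h0, zero_mul] at h1
    rw [← h0, mul_zero]
    exact (pow_eq_zero_iff two_ne_zero).1 (le_antisymm h1 (sq_nonneg _)) |>.le
  have hpow : ∀ k : ℕ, (a 1 / a 0) ^ 2 ^ k ≤ a (2 ^ k) / a 0 := by
    intro k
    induction k with
    | zero => simp
    | succ k ih =>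
      calc (a 1 / a 0) ^ 2 ^ (k + 1) = ((a 1 / a 0) ^ 2 ^ k) ^ 2 := by rw [← pow_mul, pow_succ]
        _ ≤ (a (2 ^ k) / a 0) ^ 2 :=
          pow_le_pow_left₀ (pow_nonneg (div_nonneg (ha 1) h0.le) _) ih 2
        _ ≤ a (2 ^ (k + 1)) / a 0 := by
          rw [div_pow, div_le_div_iff₀ (pow_pos h0 2) h0, pow_succ' 2 k]
          nlinarith [mul_le_mul_of_nonneg_right (hsq (2 ^ k)) h0.le]
  rw [← div_le_iff₀ h0]
  refine le_of_pow_two_pow_le_mul_pow (c := M / a 0) hK fun k => (hpow k).trans ?_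
  rw [div_mul_eq_mul_div]
  exact div_le_div_of_nonneg_right (hgeom _) h0.le

section Symmetrized

variable {H : Type*} [NormedAddCommGroup H] [InnerProductSpace ℂ H]

/-- A bounded operator `C` symmetric for the semi-inner product `⟪A ·, A ·⟫` is bounded by its
operator norm for the corresponding seminorm. -/
theorem norm_comp_apply_le_of_symm {A C : H →L[ℂ] H}
    (h : ∀ p w, ⟪A (C p), A w⟫_ℂ = ⟪A p, A (C w)⟫_ℂ) (u : H) :
    ‖A (C u)‖ ≤ ‖C‖ * ‖A u‖ := by
  have hshift : ∀ n : ℕ, ∀ p w, ⟪A ((C ^ n) p), A w⟫_ℂ = ⟪A p, A ((C ^ n) w)⟫_ℂ := by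
    intro n
    induction n with
    | zero => simp
    | succ n ih =>
      intro p w
      rw [pow_succ, mul_apply_eq_comp, ih, h, ← mul_apply_eq_comp C,
        ← pow_succ', pow_succ]
  have key := le_mul_of_sq_le_mul_of_le_geometric (a := fun n => ‖A ((C ^ n) u)‖)
    (K := ‖C‖) (M := ‖A‖ * ‖u‖) (fun _ => norm_nonneg _) (norm_nonneg _) ?_ ?_
  · simpa using key
  · intro n
    have h2 : ⟪A ((C ^ n) u), A ((C ^ n) u)⟫_ℂ = ⟪A u, A ((C ^ (2 * n)) u)⟫_ℂ := by
      rw [hshift, two_mul, pow_add, mul_apply_eq_comp]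
    have h3 := norm_inner_le_norm (𝕜 := ℂ) (A u) (A ((C ^ (2 * n)) u))
    rw [← h2, inner_self_eq_norm_sq_to_K, norm_pow] at h3
    simpa using h3
  · intro n
    have hC : ‖(C ^ n) u‖ ≤ ‖C‖ ^ n * ‖u‖ := by
      induction n with
      | zero => simp
      | succ n ih =>
        rw [pow_succ', mul_apply_eq_comp, pow_succ', mul_assoc]
        exact C.le_opNorm_of_le ih
    calc ‖A ((C ^ n) u)‖ ≤ ‖A‖ * (‖C‖ ^ n * ‖u‖) := A.le_opNorm_of_le hC
      _ = ‖A‖ * ‖u‖ * ‖C‖ ^ n := by ring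

/-- If `B₁` and `B₂` are adjoint for the semi-inner product `⟪A ·, A ·⟫`, then `B₁` is bounded for
the corresponding seminorm by the geometric mean of the operator norms. -/
theorem norm_comp_apply_le_of_adjoint {A B₁ B₂ : H →L[ℂ] H}
    (h : ∀ p w, ⟪A (B₂ p), A w⟫_ℂ = ⟪A p, A (B₁ w)⟫_ℂ) (u : H) :
    ‖A (B₁ u)‖ ≤ ‖B₁‖ ^ ((1 : ℝ) / 2) * ‖B₂‖ ^ ((1 : ℝ) / 2) * ‖A u‖ := by
  have h' : ∀ p w, ⟪A (B₁ p), A w⟫_ℂ = ⟪A p, A (B₂ w)⟫_ℂ := fun p w => by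
    rw [← inner_conj_symm, ← h, inner_conj_symm]
  have hC : ‖A (B₂ (B₁ u))‖ ≤ ‖B₂ ∘L B₁‖ * ‖A u‖ :=
    norm_comp_apply_le_of_symm (C := B₂ ∘L B₁)
      (fun p w => by simp only [ContinuousLinearMap.comp_apply, h, h']) u
  have hsq : ‖A (B₁ u)‖ ^ 2 ≤ ‖B₁‖ * ‖B₂‖ * ‖A u‖ ^ 2 := by
    have h1 := norm_inner_le_norm (𝕜 := ℂ) (A u) (A (B₂ (B₁ u)))
    rw [← h', inner_self_eq_norm_sq_to_K, norm_pow] at h1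
    simp only [Complex.coe_algebraMap, Complex.norm_real, norm_norm] at h1
    calc ‖A (B₁ u)‖ ^ 2 ≤ ‖A u‖ * ‖A (B₂ (B₁ u))‖ := by simpa using h1
      _ ≤ ‖A u‖ * (‖B₂‖ * ‖B₁‖ * ‖A u‖) := by
        gcongr
        exact hC.trans (by gcongr; exact B₂.opNorm_comp_le B₁)
      _ = ‖B₁‖ * ‖B₂‖ * ‖A u‖ ^ 2 := by ring
  rw [← Real.mul_rpow (norm_nonneg _) (norm_nonneg _), ← Real.sqrt_eq_rpow]
  refine le_of_sq_le_sq ?_ (by positivity)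
  rwa [mul_pow, Real.sq_sqrt (by positivity)]

/-- If the maximal product `T S A`, where `A = T⁻¹`, is the bounded operator `B`, then
`S A = A B`. -/
theorem IsBoundedOp.apply_inverse {T S : H →ₗ.[ℂ] H} {A B : H →L[ℂ] H}
    (hA : IsBoundedInverse T A)
    (hB : IsBoundedOp (mcomp T (mcomp S ((A : H →ₗ[ℂ] H).toPMap ⊤))) B) (u : H)
    (hu : A u ∈ S.domain) : S ⟨A u, hu⟩ = A (B u) := by
  have hmem : u ∈ (mcomp T (mcomp S ((A : H →ₗ[ℂ] H).toPMap ⊤))).domain := by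
    rw [hB.1]
    exact Submodule.mem_top
  rw [← hB.2 ⟨u, hmem⟩]
  exact (hA.1 ⟨S ⟨A u, hu⟩, hmem.choose_spec⟩).symm

/-- A closed operator that is bounded on a dense subspace of its domain is everywhere defined and
bounded, with the same bound. -/
theorem exists_isBoundedOp_of_isClosed [CompleteSpace H] {S : H →ₗ.[ℂ] H} (hS : S.IsClosed)
    {D : Submodule ℂ H} (hD : Dense (D : Set H)) (hDS : D ≤ S.domain) {c : ℝ} (hc : 0 ≤ c)
    (hbound : ∀ x (hx : x ∈ D), ‖S ⟨x, hDS hx⟩‖ ≤ c * ‖x‖) :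
    ∃ B : H →L[ℂ] H, IsBoundedOp S B ∧ ‖B‖ ≤ c := by
  let f : D →L[ℂ] H :=
    (S.toFun.comp (Submodule.inclusion hDS)).mkContinuous c fun x => hbound x x.2
  let B : H →L[ℂ] H := f.extend D.subtypeL
  have hBD : ∀ x (hx : x ∈ D), B x = S ⟨x, hDS hx⟩ := fun x hx =>
    ContinuousLinearMap.extend_eq f hD.denseRange_val
      isUniformEmbedding_subtype_val.isUniformInducing ⟨x, hx⟩
  have hgraph : ∀ x, (x, B x) ∈ S.graph := fun x => by
    have hcl : IsClosed {x | (x, B x) ∈ S.graph} :=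
      IsClosed.preimage (continuous_id.prodMk B.continuous) hS
    have hx : x ∈ closure (D : Set H) := hD x
    refine closure_minimal (fun y hy => ?_) hcl hx
    exact (LinearPMap.mem_graph_iff S).2 ⟨⟨y, hDS hy⟩, rfl, (hBD y hy).symm⟩
  refine ⟨B, ⟨Submodule.eq_top_iff'.2 fun x => LinearPMap.mem_domain_of_mem_graph (hgraph x),
    fun x => ?_⟩, B.opNorm_le_bound hc fun x => ?_⟩
  · exact ((LinearPMap.image_iff x.2).2 (hgraph x)).symm
  · have hcl : IsClosed {x | ‖B x‖ ≤ c * ‖x‖} :=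
      isClosed_le B.continuous.norm (continuous_const.mul continuous_norm)
    have hx : x ∈ closure (D : Set H) := hD x
    refine closure_minimal (fun y hy => ?_) hcl hx
    rw [Set.mem_ofPred_eq, hBD y hy]
    exact hbound y hy

/-- The adjoint of an everywhere defined bounded partial linear map is given by the adjoint
bounded operator. -/
theorem IsBoundedOp.adjoint [CompleteSpace H] {S : H →ₗ.[ℂ] H} {B : H →L[ℂ] H}
    (h : IsBoundedOp S B) : IsBoundedOp S.adjoint (ContinuousLinearMap.adjoint B) := by
  have hS : S = (B : H →ₗ[ℂ] H).toPMap ⊤ :=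
    LinearPMap.ext h.1 fun x hx _ => h.2 ⟨x, hx⟩
  rw [hS, ContinuousLinearMap.toPMap_adjoint_eq_adjoint_toPMap_of_dense B (by simp)]
  exact ⟨rfl, fun _ => rfl⟩

end Symmetrized

end OpInterp

open OpInterp in
/-- Theorem 2.5.  If `T` is self-adjoint with `T⁻¹ ∈ B(H)`, `S` is closed
with `dom S ∩ dom S* ⊇ dom T`, and `TST⁻¹, TS*T⁻¹ ∈ B(H)`, then `S ∈ B(H)`
(hence `S* ∈ B(H)`) and
`‖S‖ = ‖S*‖ ≤ e^{2π} ‖TST⁻¹‖^{1/2} ‖TS*T⁻¹‖^{1/2}`, the factor `e^{2π}` being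
replaceable by `1` when `T ≥ 0`. -/
theorem statement5
    {H : Type*} [NormedAddCommGroup H] [InnerProductSpace ℂ H] [CompleteSpace H]
    [TopologicalSpace.SeparableSpace H]
    (T S : H →ₗ.[ℂ] H) (Tinv B₁ B₂ : H →L[ℂ] H)
    (hT : IsSelfAdjoint T) (hTinv : IsBoundedInverse T Tinv)
    (hS : S.IsClosed) (hdomS : T.domain ≤ S.domain) (hdomS' : T.domain ≤ S.adjoint.domain)
    -- `TST⁻¹ = B₁ ∈ B(H)` and `TS*T⁻¹ = B₂ ∈ B(H)`:
    (hB₁ : IsBoundedOp (mcomp T (mcomp S ((Tinv : H →ₗ[ℂ] H).toPMap ⊤))) B₁)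
    (hB₂ : IsBoundedOp (mcomp T (mcomp S.adjoint ((Tinv : H →ₗ[ℂ] H).toPMap ⊤))) B₂) :
    ∃ Bs Bs' : H →L[ℂ] H,
      IsBoundedOp S Bs ∧ IsBoundedOp S.adjoint Bs' ∧
      ContinuousLinearMap.adjoint Bs = Bs' ∧ ‖Bs‖ = ‖Bs'‖ ∧
      ‖Bs‖ ≤ Real.exp (2 * Real.pi) * (‖B₁‖ ^ ((1 : ℝ) / 2) * ‖B₂‖ ^ ((1 : ℝ) / 2)) ∧
      (IsNonnegPMap T → ‖Bs‖ ≤ ‖B₁‖ ^ ((1 : ℝ) / 2) * ‖B₂‖ ^ ((1 : ℝ) / 2)) := by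
  have hDS : Dense (S.domain : Set H) := hT.dense_domain.mono hdomS
  have hrange : ∀ u, Tinv u ∈ T.domain := fun u => (hTinv.2 u).choose
  have hadj : ∀ p w, ⟪Tinv (B₂ p), Tinv w⟫_ℂ = ⟪Tinv p, Tinv (B₁ w)⟫_ℂ := fun p w => by
    rw [← hB₁.apply_inverse hTinv w (hdomS (hrange w)),
      ← hB₂.apply_inverse hTinv p (hdomS' (hrange p))]
    exact LinearPMap.adjoint_isFormalAdjoint hDS ⟨Tinv p, _⟩ ⟨Tinv w, _⟩
  have hc : 0 ≤ ‖B₁‖ ^ ((1 : ℝ) / 2) * ‖B₂‖ ^ ((1 : ℝ) / 2) := by positivity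
  obtain ⟨B, hB, hnorm⟩ := exists_isBoundedOp_of_isClosed hS hT.dense_domain hdomS hc
    fun x hx => by
      obtain ⟨u, rfl⟩ : ∃ u, Tinv u = x := ⟨T ⟨x, hx⟩, hTinv.1 ⟨x, hx⟩⟩
      rw [hB₁.apply_inverse hTinv]
      exact norm_comp_apply_le_of_adjoint hadj u
  refine ⟨B, ContinuousLinearMap.adjoint B, hB, hB.adjoint, rfl,
    (LinearIsometryEquiv.norm_map ContinuousLinearMap.adjoint B).symm,
    hnorm.trans (le_mul_of_one_le_left hc (Real.one_le_exp (by positivity))), fun _ => hnorm⟩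
end
end

section
/- Let T be a self-adjoint operator in a separable complex Hilbert space H with T ≥ 0 and T^{-1} ∈ B(H), and let S be a closed operator in H with dom(S) ∩ dom(S*) ⊇ dom(T). Then T^{-1/2}ST^{-1/2} ∈ B(H) and T^{-1/2}S*T^{-1/2} ∈ B(H), the adjoint relations (T^{-1/2}ST^{-1/2})* = T^{-1/2}S*T^{-1/2} and (T^{-1/2}S*T^{-1/2})* = T^{-1/2}ST^{-1/2} hold, and ||T^{-1/2}ST^{-1/2}||_{B(H)} = ||T^{-1/2}S*T^{-1/2}||_{B(H)} ≤ ||ST^{-1}||_{B(H)}^{1/2} · ||S*T^{-1}||_{B(H)}^{1/2}. -/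
noncomputable section

open scoped ENNReal InnerProductSpace

theorem le_mul_of_sq_le_mul_of_le_mul_pow {a : ℕ → ℝ} {M k : ℝ} (ha : ∀ n, 0 ≤ a n) (hk : 0 ≤ k)
    (hconv : ∀ n, a (n + 1) ^ 2 ≤ a n * a (n + 2)) (hbd : ∀ n, a n ≤ M * k ^ n) :
    a 1 ≤ k * a 0 := by
  rcases (ha 0).eq_or_lt with h0 | h0
  · have h := hconv 0
    rw [← h0, zero_mul] at h
    rw [← h0, mul_zero]
    exact (pow_eq_zero_iff two_ne_zero).1 (le_antisymm h (sq_nonneg _)) |>.le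
  by_contra! hlt
  obtain ⟨q, hq⟩ : ∃ q, q = a 1 / a 0 := ⟨_, rfl⟩
  have hkq : k < q := by rw [hq, lt_div_iff₀ h0]; exact hlt
  have hq0 : 0 < q := hk.trans_lt hkq
  have hstep : ∀ n, 0 < a n ∧ q * a n ≤ a (n + 1) := by
    intro n
    induction n with
    | zero => exact ⟨h0, by rw [hq, div_mul_cancel₀ _ h0.ne']⟩
    | succ n ih =>
      have hpos : 0 < a (n + 1) := (mul_pos hq0 ih.1).trans_le ih.2
      refine ⟨hpos, le_of_mul_le_mul_left ?_ ih.1⟩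
      nlinarith [hconv n, mul_le_mul_of_nonneg_right ih.2 hpos.le]
  have hgrowth : ∀ n, q ^ n * a 0 ≤ a n := by
    intro n
    induction n with
    | zero => simp
    | succ n ih =>
      calc q ^ (n + 1) * a 0 = q * (q ^ n * a 0) := by ring
        _ ≤ q * a n := by gcongr
        _ ≤ a (n + 1) := (hstep n).2
  rcases hk.eq_or_lt with rfl | hk
  · have h1 := (hstep 1).1
    have h2 := hbd 1
    simp only [pow_one, mul_zero] at h2
    exact absurd h2 h1.not_ge
  · obtain ⟨n, hn⟩ := pow_unbounded_of_one_lt (M / a 0) ((one_lt_div hk).2 hkq)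
    have h := (hgrowth n).trans (hbd n)
    rw [div_pow, div_lt_div_iff₀ h0 (pow_pos hk n)] at hn
    exact absurd h hn.not_ge

section Symmetrizable

variable {H : Type*} [NormedAddCommGroup H] [InnerProductSpace ℂ H]

/-- Krein's inequality: an operator that is symmetric for the semi-inner product
`⟪R x, R y⟫` is bounded for the associated seminorm, with at most its original norm. -/
theorem norm_apply_comp_le_of_symmetric {R K : H →L[ℂ] H}
    (hK : ∀ x y, ⟪R (K x), R y⟫_ℂ = ⟪R x, R (K y)⟫_ℂ) (x : H) :
    ‖R (K x)‖ ≤ ‖K‖ * ‖R x‖ := by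
  have hsucc : ∀ n, (K ^ (n + 1)) x = K ((K ^ n) x) := fun n => by
    rw [pow_succ']; rfl
  have h := le_mul_of_sq_le_mul_of_le_mul_pow (a := fun n => ‖R ((K ^ n) x)‖)
    (M := ‖R‖ * ‖x‖) (k := ‖K‖) (fun n => norm_nonneg _) (norm_nonneg _) ?_ ?_
  · simpa using h
  · intro n
    have hin : ⟪R ((K ^ (n + 1)) x), R ((K ^ (n + 1)) x)⟫_ℂ
        = ⟪R ((K ^ n) x), R ((K ^ (n + 2)) x)⟫_ℂ := by
      rw [hsucc (n + 1), ← hK, ← hsucc]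
    calc ‖R ((K ^ (n + 1)) x)‖ ^ 2
        = ‖⟪R ((K ^ n) x), R ((K ^ (n + 2)) x)⟫_ℂ‖ := by
          rw [← hin, inner_self_eq_norm_sq_to_K]; simp
      _ ≤ _ := norm_inner_le_norm _ _
  · intro n
    have hpow : ‖(K ^ n) x‖ ≤ ‖K‖ ^ n * ‖x‖ := by
      induction n with
      | zero => simp
      | succ n ih =>
        rw [hsucc, pow_succ', mul_assoc]
        exact (K.le_opNorm _).trans (by gcongr)
    calc ‖R ((K ^ n) x)‖ ≤ ‖R‖ * (‖K‖ ^ n * ‖x‖) := (R.le_opNorm _).trans (by gcongr)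
      _ = ‖R‖ * ‖x‖ * ‖K‖ ^ n := by ring

theorem norm_apply_comp_le_sqrt_of_formalAdjoint {R C D : H →L[ℂ] H}
    (h : ∀ x y, ⟪R (C x), R y⟫_ℂ = ⟪R x, R (D y)⟫_ℂ) (x : H) :
    ‖R (C x)‖ ≤ √(‖C‖ * ‖D‖) * ‖R x‖ := by
  have h' : ∀ x y, ⟪R (D x), R y⟫_ℂ = ⟪R x, R (C y)⟫_ℂ := fun x y => by
    rw [← inner_conj_symm, ← h, inner_conj_symm]
  have hK := norm_apply_comp_le_of_symmetric (R := R) (K := D ∘L C)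
    (fun x y => by simp only [ContinuousLinearMap.comp_apply]; rw [h', h]) x
  have hnorm : ‖R (C x)‖ ^ 2 ≤ ‖C‖ * ‖D‖ * ‖R x‖ ^ 2 := by
    calc ‖R (C x)‖ ^ 2 = ‖⟪R x, R (D (C x))⟫_ℂ‖ := by
          rw [← h, inner_self_eq_norm_sq_to_K]; simp
      _ ≤ ‖R x‖ * ‖R (D (C x))‖ := norm_inner_le_norm _ _
      _ ≤ ‖R x‖ * (‖D ∘L C‖ * ‖R x‖) := by gcongr; exact hK
      _ ≤ ‖R x‖ * (‖D‖ * ‖C‖ * ‖R x‖) := by gcongr; exact D.opNorm_comp_le C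
      _ = ‖C‖ * ‖D‖ * ‖R x‖ ^ 2 := by ring
  rw [← Real.sqrt_sq (norm_nonneg (R x)), ← Real.sqrt_mul (by positivity)]
  exact Real.le_sqrt_of_sq_le hnorm

end Symmetrizable

namespace OpInterp

variable {H : Type*} [NormedAddCommGroup H] [InnerProductSpace ℂ H]

theorem IsBoundedInverse.denseRange {T : H →ₗ.[ℂ] H} {R : H →L[ℂ] H}
    (h : IsBoundedInverse T R) (hT : Dense (T.domain : Set H)) : DenseRange R :=
  hT.mono fun x hx => ⟨T ⟨x, hx⟩, h.1 ⟨x, hx⟩⟩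

theorem IsBoundedInverse.inner_apply_comm [CompleteSpace H] {T : H →ₗ.[ℂ] H} {R : H →L[ℂ] H}
    (h : IsBoundedInverse T R) (hT : IsSelfAdjoint T) (x y : H) :
    ⟪R x, y⟫_ℂ = ⟪x, R y⟫_ℂ := by
  have hformal : T.IsFormalAdjoint T := by
    have hadj := LinearPMap.adjoint_isFormalAdjoint hT.dense_domain
    rwa [LinearPMap.isSelfAdjoint_def.1 hT] at hadj
  obtain ⟨hx, hTx⟩ := h.2 x
  obtain ⟨hy, hTy⟩ := h.2 y
  simpa only [hTx, hTy] using (hformal ⟨R x, hx⟩ ⟨R y, hy⟩).symm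

theorem IsBoundedInverse.mcomp_apply {Q : H →ₗ.[ℂ] H} {A R : H →L[ℂ] H}
    (hA : IsBoundedInverse (mcomp Q Q) A) (hR : IsBoundedInverse Q R) (y : H) :
    R (R y) = A y := by
  obtain ⟨hy, hQy⟩ := hR.2 y
  obtain ⟨hRy, hQRy⟩ := hR.2 (R y)
  have hmem : R (R y) ∈ (mcomp Q Q).domain := ⟨hRy, by rw [hQRy]; exact hy⟩
  have happ : mcomp Q Q ⟨R (R y), hmem⟩ = y := by
    have heq : (⟨Q ⟨R (R y), hRy⟩, by rw [hQRy]; exact hy⟩ : Q.domain) = ⟨R y, hy⟩ :=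
      Subtype.ext hQRy
    change Q ⟨Q ⟨R (R y), hRy⟩, _⟩ = y
    rw [heq, hQy]
  have := hA.1 ⟨R (R y), hmem⟩
  rw [happ] at this
  exact this.symm

/-- If `S` is formally adjoint to the operator sending `R (R y)` to `D y`, then a bounded
operator `B` with the matching sesquilinear form on `ran R` extends `R S R`. -/
theorem extendsTo_compPMap_mcomp {S : H →ₗ.[ℂ] H} {R D B : H →L[ℂ] H} (hR : DenseRange R)
    (hsymm : ∀ x y, ⟪R x, y⟫_ℂ = ⟪x, R y⟫_ℂ)
    (hSD : ∀ (u : S.domain) (y : H), ⟪S u, R (R y)⟫_ℂ = ⟪(u : H), D y⟫_ℂ)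
    (hB : ∀ x y, ⟪B x, R y⟫_ℂ = ⟪x, R (D y)⟫_ℂ) :
    ExtendsTo (LinearMap.compPMap (R : H →ₗ[ℂ] H)
      (mcomp S ((R : H →ₗ[ℂ] H).toPMap ⊤))) B := by
  rintro ⟨x, hx⟩
  have hRx : R x ∈ S.domain := hx.2
  refine hR.eq_of_inner_left ℂ fun y => ?_
  change ⟪R (S ⟨R x, hRx⟩), R y⟫_ℂ = ⟪B x, R y⟫_ℂ
  rw [hsymm, hSD, hB, hsymm]

theorem dense_compPMap_mcomp_domain {S : H →ₗ.[ℂ] H} {R : H →L[ℂ] H} (hR : DenseRange R)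
    (hS : ∀ y, R (R y) ∈ S.domain) :
    Dense ((LinearMap.compPMap (R : H →ₗ[ℂ] H)
      (mcomp S ((R : H →ₗ[ℂ] H).toPMap ⊤))).domain : Set H) := by
  refine hR.mono ?_
  rintro _ ⟨y, rfl⟩
  exact ⟨Submodule.mem_top, hS y⟩

end OpInterp

open OpInterp in
/-- Theorem 2.6.  Let `T ≥ 0` be self-adjoint with `T⁻¹ ∈ B(H)` and let
`S` be closed with `dom S ∩ dom S* ⊇ dom T` (so `ST⁻¹, S*T⁻¹ ∈ B(H)`).  Then
`T^{-1/2}ST^{-1/2}, T^{-1/2}S*T^{-1/2} ∈ B(H)`, they are adjoints of each other, and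
`‖T^{-1/2}ST^{-1/2}‖ = ‖T^{-1/2}S*T^{-1/2}‖ ≤ ‖ST⁻¹‖^{1/2} ‖S*T⁻¹‖^{1/2}`. -/
theorem statement6
    {H : Type*} [NormedAddCommGroup H] [InnerProductSpace ℂ H] [CompleteSpace H]
    [TopologicalSpace.SeparableSpace H]
    (T S sqrtT : H →ₗ.[ℂ] H) (Tinv sqrtTinv STinv SstarTinv : H →L[ℂ] H)
    (hT : IsSelfAdjoint T) (hTnn : IsNonnegPMap T) (hTinv : IsBoundedInverse T Tinv)
    (hS : S.IsClosed)
    (hdomS : T.domain ≤ S.domain) (hdomS' : T.domain ≤ S.adjoint.domain)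
    -- `T^{1/2}` and `T^{-1/2}`, given by the spectral theorem:
    (hsqrt_sa : IsSelfAdjoint sqrtT) (hsqrt_nn : IsNonnegPMap sqrtT)
    (hsqrt_sq : mcomp sqrtT sqrtT = T) (hsqrtinv : IsBoundedInverse sqrtT sqrtTinv)
    -- `ST⁻¹ = STinv ∈ B(H)` and `S*T⁻¹ = SstarTinv ∈ B(H)`:
    (hSTinv : IsComposition S Tinv STinv)
    (hSstarTinv : IsComposition S.adjoint Tinv SstarTinv) :
    ∃ B Bstar : H →L[ℂ] H,
      ExtendsTo (LinearMap.compPMap (sqrtTinv : H →ₗ[ℂ] H)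
        (mcomp S ((sqrtTinv : H →ₗ[ℂ] H).toPMap ⊤))) B ∧
      ExtendsTo (LinearMap.compPMap (sqrtTinv : H →ₗ[ℂ] H)
        (mcomp S.adjoint ((sqrtTinv : H →ₗ[ℂ] H).toPMap ⊤))) Bstar ∧
      Dense ((LinearMap.compPMap (sqrtTinv : H →ₗ[ℂ] H)
        (mcomp S ((sqrtTinv : H →ₗ[ℂ] H).toPMap ⊤))).domain : Set H) ∧
      Dense ((LinearMap.compPMap (sqrtTinv : H →ₗ[ℂ] H)
        (mcomp S.adjoint ((sqrtTinv : H →ₗ[ℂ] H).toPMap ⊤))).domain : Set H) ∧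
      -- the adjoint relations:
      ContinuousLinearMap.adjoint B = Bstar ∧ ContinuousLinearMap.adjoint Bstar = B ∧
      -- equality of norms and the bound:
      ‖B‖ = ‖Bstar‖ ∧
      ‖B‖ ≤ ‖STinv‖ ^ ((1 : ℝ) / 2) * ‖SstarTinv‖ ^ ((1 : ℝ) / 2) := by
  have hSdense : Dense (S.domain : Set H) := hT.dense_domain.mono hdomS
  have hadj := LinearPMap.adjoint_isFormalAdjoint hSdense
  have hR : DenseRange sqrtTinv := hsqrtinv.denseRange hsqrt_sa.dense_domain
  have hsymm := hsqrtinv.inner_apply_comm hsqrt_sa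
  have hRR : ∀ y, sqrtTinv (sqrtTinv y) = Tinv y := by
    subst hsqrt_sq
    exact hTinv.mcomp_apply hsqrtinv
  have hSD : ∀ (u : S.domain) (y : H),
      ⟪S u, sqrtTinv (sqrtTinv y)⟫_ℂ = ⟪(u : H), SstarTinv y⟫_ℂ := fun u y => by
    obtain ⟨hy, hSy⟩ := hSstarTinv y
    rw [hRR, ← hSy]
    exact hadj.symm u ⟨Tinv y, hy⟩
  have hSC : ∀ (u : S.adjoint.domain) (y : H),
      ⟪S.adjoint u, sqrtTinv (sqrtTinv y)⟫_ℂ = ⟪(u : H), STinv y⟫_ℂ := fun u y => by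
    obtain ⟨hy, hSy⟩ := hSTinv y
    rw [hRR, ← hSy]
    exact hadj u ⟨Tinv y, hy⟩
  have hCD : ∀ x y, ⟪sqrtTinv (STinv x), sqrtTinv y⟫_ℂ
      = ⟪sqrtTinv x, sqrtTinv (SstarTinv y)⟫_ℂ := fun x y => by
    obtain ⟨hx, hSx⟩ := hSTinv x
    rw [hsymm, ← hSx, hSD, ← hsymm, hRR]
  have hnorm := norm_apply_comp_le_sqrt_of_formalAdjoint hCD
  let B : H →L[ℂ] H :=
    ((sqrtTinv ∘L STinv : H →L[ℂ] H) : H →ₗ[ℂ] H).extendOfNorm (sqrtTinv : H →ₗ[ℂ] H)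
  have hBR : ∀ x, B (sqrtTinv x) = sqrtTinv (STinv x) :=
    LinearMap.extendOfNorm_eq (f := ((sqrtTinv ∘L STinv : H →L[ℂ] H) : H →ₗ[ℂ] H))
      (e := (sqrtTinv : H →ₗ[ℂ] H)) hR ⟨_, hnorm⟩
  have hBadj : ∀ y, ContinuousLinearMap.adjoint B (sqrtTinv y) = sqrtTinv (SstarTinv y) :=
    fun y => hR.eq_of_inner_right ℂ fun x => by
      rw [ContinuousLinearMap.adjoint_inner_right, hBR, hCD]
  refine ⟨B, ContinuousLinearMap.adjoint B,
    extendsTo_compPMap_mcomp hR hsymm hSD fun x y => ?_,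
    extendsTo_compPMap_mcomp hR hsymm hSC fun x y => ?_,
    dense_compPMap_mcomp_domain hR fun y => ?_,
    dense_compPMap_mcomp_domain hR fun y => ?_,
    rfl, ContinuousLinearMap.adjoint_adjoint B,
    (LinearIsometryEquiv.norm_map ContinuousLinearMap.adjoint B).symm, ?_⟩
  · rw [← hBadj, ContinuousLinearMap.adjoint_inner_right]
  · rw [ContinuousLinearMap.adjoint_inner_left, hBR]
  · rw [hRR]; exact (hSTinv y).1
  · rw [hRR]; exact (hSstarTinv y).1
  · rw [← Real.sqrt_eq_rpow, ← Real.sqrt_eq_rpow, ← Real.sqrt_mul (norm_nonneg _)]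
    exact LinearMap.opNorm_extendOfNorm_le hR (Real.sqrt_nonneg _) hnorm
end
end

section
/- Let T be a self-adjoint operator in a separable complex Hilbert space H with T^{-1} ∈ B(H), and let S be a closed operator in H with dom(S) ∩ dom(S*) ⊇ dom(T). Then for every k ∈ (0,∞) and every z ∈ Σ̄ = {z : Re z ∈ [0,1]}, ||cl(T^{-z}ST^{-1+z})||_{B(H)} ≤ e^{k|Im z|² + k Re z(1−Re z) + k^{-1}π²} · ||ST^{-1}||_{B(H)}^{1−Re z} · ||S*T^{-1}||_{B(H)}^{Re z}, and if T ≥ 0 the exponential prefactor can be replaced by 1. Consequently, for x ∈ [0,1], ||cl(T^{-x}ST^{-1+x})||_{B(H)} ≤ e^{2π[x(1−x)]^{1/2}} · ||ST^{-1}||_{B(H)}^{1−x} · ||S*T^{-1}||_{B(H)}^{x}, with prefactor 1 if T ≥ 0. -/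
noncomputable section

open scoped ENNReal InnerProductSpace

namespace OpInterp

section Auxiliary

open Filter Topology Complex.HadamardThreeLines

variable {H : Type*} [NormedAddCommGroup H] [NormedSpace ℂ H]

/-- Strong convergence of bounded operators is compatible with evaluation on convergent vectors. -/
theorem tendsto_apply_of_norm_le {α : Type*} {l : Filter α} {P : α → H →L[ℂ] H} {v : α → H}
    {P₀ : H →L[ℂ] H} {v₀ : H} {M : ℝ} (hM : ∀ᶠ w in l, ‖P w‖ ≤ M)
    (hP : Tendsto (fun w => P w v₀) l (𝓝 (P₀ v₀))) (hv : Tendsto v l (𝓝 v₀)) :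
    Tendsto (fun w => P w (v w)) l (𝓝 (P₀ v₀)) := by
  have h1 : Tendsto (fun w => P w (v w - v₀)) l (𝓝 0) := by
    have h2 : Tendsto (fun w => M * ‖v w - v₀‖) l (𝓝 0) := by
      simpa using ((tendsto_sub_nhds_zero_iff.mpr hv).norm).const_mul M
    refine squeeze_zero_norm' ?_ h2
    filter_upwards [hM] with w hw
    exact (P w).le_of_opNorm_le hw _
  simpa using h1.add hP

theorem differentiableAt_apply_of_norm_le {P : ℂ → H →L[ℂ] H} {v : ℂ → H} {z : ℂ} {M : ℝ}
    (hM : ∀ᶠ w in 𝓝 z, ‖P w‖ ≤ M) (hP : ∀ x, DifferentiableAt ℂ (fun w => P w x) z)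
    (hv : DifferentiableAt ℂ v z) : DifferentiableAt ℂ (fun w => P w (v w)) z := by
  have h1 := hasDerivAt_iff_tendsto_slope.mp hv.hasDerivAt
  have h2 := hasDerivAt_iff_tendsto_slope.mp (hP (v z)).hasDerivAt
  have h3 := tendsto_apply_of_norm_le (P₀ := P z) (hM.filter_mono nhdsWithin_le_nhds)
    ((hP (deriv v z)).continuousAt.tendsto.mono_left nhdsWithin_le_nhds) h1
  refine (hasDerivAt_iff_tendsto_slope.mpr ((h3.add h2).congr fun w => ?_)).differentiableAt
  simp only [slope_def_module, map_smul, map_sub, ← smul_add]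
  congr 1
  abel

theorem linear_sub_sq_le {k : ℝ} (hk : 0 < k) (c s : ℝ) : c * s - k * s ^ 2 ≤ k⁻¹ * c ^ 2 := by
  have h : k⁻¹ * c ^ 2 - (c * s - k * s ^ 2)
      = k⁻¹ * ((c - k * s / 2) ^ 2 + 3 / 4 * (k * s) ^ 2) := by
    field_simp
    ring
  have : 0 ≤ k⁻¹ * ((c - k * s / 2) ^ 2 + 3 / 4 * (k * s) ^ 2) := by positivity
  linarith

theorem norm_exp_quadratic (k : ℝ) (z : ℂ) :
    ‖Complex.exp (k * (z * (z - 1)))‖ =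
      Real.exp (-(k * z.im ^ 2 + k * (z.re * (1 - z.re)))) := by
  rw [Complex.norm_exp]
  congr 1
  simp
  ring

theorem norm_le_gaussian_interp {f : ℂ → H} (hf : DiffContOnCl ℂ f (verticalStrip 0 1))
    {C d : ℝ} (hC : 0 ≤ C)
    (hgrowth : ∀ z ∈ verticalClosedStrip 0 1, ‖f z‖ ≤ C * Real.exp (d * |z.im|))
    {a b c k : ℝ} (ha : 0 ≤ a) (hb : 0 ≤ b) (hk : 0 < k)
    (h0 : ∀ s : ℝ, ‖f (Complex.I * s)‖ ≤ Real.exp (c * |s|) * a)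
    (h1 : ∀ s : ℝ, ‖f (1 + Complex.I * s)‖ ≤ Real.exp (c * |s|) * b)
    {z : ℂ} (hz : z ∈ verticalClosedStrip 0 1) :
    ‖f z‖ ≤ Real.exp (k * z.im ^ 2 + k * (z.re * (1 - z.re)) + k⁻¹ * c ^ 2) *
      (a ^ (1 - z.re) * b ^ z.re) := by
  set D := Real.exp (k⁻¹ * c ^ 2)
  have hD : 0 < D := Real.exp_pos _
  set g : ℂ → H := fun z => Complex.exp (k * (z * (z - 1))) • f z
  have hg : ∀ z, ‖g z‖ = Real.exp (-(k * z.im ^ 2 + k * (z.re * (1 - z.re)))) * ‖f z‖ := by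
    intro z
    rw [norm_smul, norm_exp_quadratic]
  have hgd : DiffContOnCl ℂ g (verticalStrip 0 1) := by
    refine DiffContOnCl.smul (Differentiable.diffContOnCl ?_) hf
    fun_prop
  have hB : BddAbove ((norm ∘ g) '' verticalClosedStrip 0 1) := by
    refine ⟨Real.exp (k⁻¹ * d ^ 2) * C, ?_⟩
    rintro _ ⟨w, hw, rfl⟩
    simp only [Function.comp, hg]
    have hw' : 0 ≤ w.re * (1 - w.re) := mul_nonneg hw.1 (sub_nonneg.mpr hw.2)
    calc _ ≤ Real.exp (-(k * w.im ^ 2 + k * (w.re * (1 - w.re)))) *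
          (C * Real.exp (d * |w.im|)) := by gcongr; exact hgrowth w hw
      _ = Real.exp (d * |w.im| - k * w.im ^ 2 - k * (w.re * (1 - w.re))) * C := by
          rw [mul_left_comm, ← Real.exp_add, mul_comm]
          ring_nf
      _ ≤ _ := by
          gcongr
          have := linear_sub_sq_le hk d |w.im|
          rw [sq_abs] at this
          have := mul_nonneg hk.le hw'
          linarith
  have edge : ∀ {s m : ℝ} {w : ℂ}, 0 ≤ m → w.im = s → w.re * (1 - w.re) = 0 →
      ‖f w‖ ≤ Real.exp (c * |s|) * m → ‖g w‖ ≤ D * m := by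
    intro s m w hm hs hre hfw
    rw [hg, hre, hs]
    calc _ ≤ Real.exp (-(k * s ^ 2 + k * 0)) * (Real.exp (c * |s|) * m) := by gcongr
      _ = Real.exp (c * |s| - k * s ^ 2) * m := by
          rw [← mul_assoc, ← Real.exp_add]
          ring_nf
      _ ≤ _ := by
          have := linear_sub_sq_le hk c |s|
          rw [sq_abs] at this
          exact mul_le_mul_of_nonneg_right (Real.exp_le_exp.mpr this) hm
  have key := norm_le_interp_of_mem_verticalClosedStrip₀₁' g (a := D * a) (b := D * b) hz hgd hB
    (by
      intro w (hw : w.re = 0)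
      refine edge ha rfl (by simp [hw]) ?_
      have : w = Complex.I * w.im := by apply Complex.ext <;> simp [hw]
      rw [this]
      simpa using h0 w.im)
    (by
      intro w (hw : w.re = 1)
      refine edge hb rfl (by simp [hw]) ?_
      have : w = 1 + Complex.I * w.im := by apply Complex.ext <;> simp [hw]
      rw [this]
      simpa using h1 w.im)
  rw [Real.mul_rpow hD.le ha, Real.mul_rpow hD.le hb, mul_mul_mul_comm, ← Real.rpow_add hD,
    sub_add_cancel, Real.rpow_one, hg, Real.exp_neg, inv_mul_le_iff₀ (Real.exp_pos _)] at key
  rw [Real.exp_add _ (k⁻¹ * c ^ 2), mul_assoc]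
  exact key

end Auxiliary

section SpectralPowers

open Filter Topology Complex.HadamardThreeLines

variable {H : Type*} [NormedAddCommGroup H] [InnerProductSpace ℂ H]
  {T : H →ₗ.[ℂ] H} {R A A' : H →L[ℂ] H} {P : ℂ → H →L[ℂ] H}

theorem IsSpectralInvPowers.norm_le_exp (hP : IsSpectralInvPowers T R P) {z : ℂ}
    (hz : z ∈ verticalClosedStrip 0 1) :
    ‖P z‖ ≤ max 1 ‖R‖ * Real.exp (Real.pi * |z.im|) := by
  have h := hP.norm_le z hz
  rwa [max_eq_right (a := (1 : ℝ))
    (Real.one_le_exp (mul_nonneg Real.pi_pos.le (abs_nonneg _)))] at h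

theorem IsSpectralInvPowers.eventually_norm_le (hP : IsSpectralInvPowers T R P) (z : ℂ) :
    ∀ᶠ w in 𝓝 z, w ∈ verticalClosedStrip 0 1 →
      ‖P w‖ ≤ max 1 ‖R‖ * Real.exp (Real.pi * (|z.im| + 1)) := by
  have hc : ContinuousAt (fun w : ℂ => |w.im|) z := by fun_prop
  filter_upwards [hc.eventually_lt continuousAt_const (lt_add_one |z.im|)] with w hw hws
  refine (hP.norm_le_exp hws).trans ?_
  have := Real.pi_pos
  gcongr

theorem one_sub_mem_verticalClosedStrip {z : ℂ} (hz : z ∈ verticalClosedStrip 0 1) :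
    1 - z ∈ verticalClosedStrip 0 1 := by
  have h0 : 0 ≤ z.re := hz.1
  have h1 : z.re ≤ 1 := hz.2
  constructor <;> simp <;> linarith

theorem IsSpectralInvPowers.commute_inv (hP : IsSpectralInvPowers T R P) {z : ℂ} (hz : 0 ≤ z.re)
    (u : H) : P z (R u) = R (P z u) := by
  have h1 := hP.semigroup z 1 hz (by simp)
  have h2 := hP.semigroup 1 z (by simp) hz
  rw [add_comm, h1, hP.one] at h2
  exact DFunLike.congr_fun h2 u

theorem IsSpectralInvPowers.diffContOnCl (hP : IsSpectralInvPowers T R P) (A : H →L[ℂ] H)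
    (u : H) : DiffContOnCl ℂ (fun z => P z (A (P (1 - z) u))) (verticalStrip 0 1) := by
  have hcl : closure (verticalStrip 0 1) ⊆ verticalClosedStrip 0 1 :=
    closure_minimal (fun z hz => ⟨hz.1.le, hz.2.le⟩) (isClosed_Icc.preimage Complex.continuous_re)
  constructor
  · intro z hz
    have hz' : 0 < (1 - z).re := by simpa using hz.2
    have hopen : IsOpen {w : ℂ | 0 < w.re} := isOpen_lt continuous_const Complex.continuous_re
    have hstrip : verticalStrip 0 1 ∈ 𝓝 z :=
      (isOpen_Ioo.preimage Complex.continuous_re).mem_nhds hz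
    have hda : ∀ x w, 0 < Complex.re w → DifferentiableAt ℂ (fun z => P z x) w := fun x w hw =>
      (hP.analytic x).differentiableAt (hopen.mem_nhds hw)
    refine (differentiableAt_apply_of_norm_le
      (M := max 1 ‖R‖ * Real.exp (Real.pi * (|z.im| + 1))) ?_ (fun x => hda x z hz.1)
      ?_).differentiableWithinAt
    · filter_upwards [hP.eventually_norm_le z, hstrip] with w hw hws
      exact hw ⟨hws.1.le, hws.2.le⟩
    · exact A.differentiableAt.comp z ((hda u _ hz').comp z (by fun_prop))
  · intro z hz
    have hzc := hcl hz
    have hmem : ∀ᶠ w in 𝓝[closure (verticalStrip 0 1)] z, w ∈ verticalClosedStrip 0 1 :=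
      (eventually_mem_nhdsWithin).mono fun w hw => hcl hw
    refine tendsto_apply_of_norm_le
      (M := max 1 ‖R‖ * Real.exp (Real.pi * (|z.im| + 1))) ?_ ?_ ?_
    · filter_upwards [(hP.eventually_norm_le z).filter_mono nhdsWithin_le_nhds, hmem] with w hw hws
      exact hw hws
    · exact (hP.strong_continuous _ z hzc.1).mono fun w hw => (hcl hw).1
    · refine (A.continuous.tendsto _).comp ?_
      have h1 := hP.strong_continuous u (1 - z) (one_sub_mem_verticalClosedStrip hzc).1
      refine h1.tendsto.comp (tendsto_nhdsWithin_iff.mpr ⟨?_, ?_⟩)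
      · exact ((continuous_const.sub continuous_id).tendsto z).mono_left nhdsWithin_le_nhds
      · exact hmem.mono fun w hw => (one_sub_mem_verticalClosedStrip hw).1

theorem IsSpectralInvPowers.norm_sandwich_growth (hP : IsSpectralInvPowers T R P)
    (A : H →L[ℂ] H) (u : H) {z : ℂ} (hz : z ∈ verticalClosedStrip 0 1) :
    ‖P z (A (P (1 - z) u))‖ ≤
      max 1 ‖R‖ ^ 2 * ‖A‖ * ‖u‖ * Real.exp (2 * Real.pi * |z.im|) := by
  have h1 := hP.norm_le_exp hz
  have h2 := hP.norm_le_exp (one_sub_mem_verticalClosedStrip hz)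
  have him : |(1 - z).im| = |z.im| := by simp
  rw [him] at h2
  calc _ ≤ ‖P z‖ * (‖A‖ * (‖P (1 - z)‖ * ‖u‖)) :=
        (P z).le_opNorm_of_le (A.le_opNorm_of_le ((P (1 - z)).le_opNorm u))
    _ ≤ (max 1 ‖R‖ * Real.exp (Real.pi * |z.im|)) *
          (‖A‖ * ((max 1 ‖R‖ * Real.exp (Real.pi * |z.im|)) * ‖u‖)) := by gcongr
    _ = _ := by
        rw [mul_assoc 2, two_mul, Real.exp_add]
        ring

/-- The interpolation estimate on vectors in the range of `R = T⁻¹`, where `A` and `A'` play the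
roles of `S T⁻¹` and `S^* T⁻¹`, in terms of a growth rate for the imaginary powers. -/
theorem IsSpectralInvPowers.norm_sandwich_le [CompleteSpace H]
    (hP : IsSpectralInvPowers T R P)
    (hRA : ∀ u, R (A u) = A'.adjoint (R u)) {c : ℝ}
    (hc : ∀ s : ℝ, ‖P (Complex.I * s)‖ * ‖P (Complex.I * (-s : ℝ))‖ ≤ Real.exp (c * |s|))
    {k : ℝ} (hk : 0 < k) {z : ℂ} (hz : z ∈ verticalClosedStrip 0 1) (u : H) :
    ‖P z (A (P (1 - z) u))‖ ≤
      Real.exp (k * z.im ^ 2 + k * (z.re * (1 - z.re)) + k⁻¹ * c ^ 2) *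
        (‖A‖ ^ (1 - z.re) * ‖A'‖ ^ z.re) * ‖R u‖ := by
  have hI : ∀ s : ℝ, 0 ≤ (Complex.I * s).re := fun s => by simp
  have edge : ∀ (s : ℝ) (B : H →L[ℂ] H),
      ‖P (Complex.I * s) (B (P (Complex.I * (-s : ℝ)) (R u)))‖
        ≤ Real.exp (c * |s|) * (‖B‖ * ‖R u‖) := fun s B =>
    calc _ ≤ ‖P (Complex.I * s)‖ * (‖B‖ * (‖P (Complex.I * (-s : ℝ))‖ * ‖R u‖)) :=
          (P _).le_opNorm_of_le (B.le_opNorm_of_le ((P _).le_opNorm _))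
      _ = ‖P (Complex.I * s)‖ * ‖P (Complex.I * (-s : ℝ))‖ * (‖B‖ * ‖R u‖) := by ring
      _ ≤ _ := by gcongr; exact hc s
  have key := norm_le_gaussian_interp (hP.diffContOnCl A u) (a := ‖A‖ * ‖R u‖)
    (b := ‖A'‖ * ‖R u‖) (c := c) (by positivity)
    (fun w hw => hP.norm_sandwich_growth A u hw) (by positivity) (by positivity) hk
    (fun s => by
      have h : 1 - Complex.I * s = Complex.I * (-s : ℝ) + 1 := by push_cast; ring
      rw [h, hP.semigroup _ _ (hI _) (by simp), hP.one]
      exact edge s A)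
    (fun s => by
      have h : 1 - (1 + Complex.I * s) = Complex.I * (-s : ℝ) := by push_cast; ring
      rw [h, add_comm, hP.semigroup _ _ (hI _) (by simp), hP.one, ContinuousLinearMap.comp_apply,
        hRA, ← hP.commute_inv (hI _)]
      simpa using edge s A'.adjoint)
    hz
  refine key.trans_eq ?_
  rcases (norm_nonneg (R u)).eq_or_lt with h | h
  · rw [← h, mul_zero, mul_zero, mul_zero]
    rcases eq_or_ne z.re 0 with h0 | h0
    · simp [h0]
    · simp [Real.zero_rpow h0]
  · rw [Real.mul_rpow (norm_nonneg _) h.le, Real.mul_rpow (norm_nonneg _) h.le,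
      mul_mul_mul_comm (‖A‖ ^ _), ← Real.rpow_add h, sub_add_cancel, Real.rpow_one]
    ring

theorem IsSpectralInvPowers.norm_imaginary_mul_le (hP : IsSpectralInvPowers T R P) (s : ℝ) :
    ‖P (Complex.I * s)‖ * ‖P (Complex.I * (-s : ℝ))‖ ≤ Real.exp (Real.pi * |s|) := by
  have hpi := Real.pi_pos
  have h := mul_le_mul (hP.norm_imaginary s) (hP.norm_imaginary (-s)) (norm_nonneg _)
    (zero_le_one.trans (le_max_left _ _))
  refine h.trans_eq ?_
  rcases le_total 0 s with hs | hs
  · rw [max_eq_right (Real.one_le_exp (by positivity)), max_eq_left, abs_of_nonneg hs, mul_one]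
    exact Real.exp_le_one_iff.mpr (by nlinarith)
  · rw [max_eq_left, max_eq_right (Real.one_le_exp (by nlinarith)), abs_of_nonpos hs, one_mul]
    exact Real.exp_le_one_iff.mpr (by nlinarith)

theorem IsSpectralInvPowers.norm_imaginary_mul_le_of_nonneg (hP : IsSpectralInvPowers T R P)
    (hT : IsNonnegPMap T) (s : ℝ) :
    ‖P (Complex.I * s)‖ * ‖P (Complex.I * (-s : ℝ))‖ ≤ Real.exp (0 * |s|) := by
  have h : ∀ t : ℝ, ‖P (Complex.I * t)‖ ≤ 1 := fun t =>
    (P _).opNorm_le_bound zero_le_one fun x => by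
      rw [one_mul, hP.isometry_imaginary_of_nonneg hT]
  simpa using mul_le_one₀ (h s) (norm_nonneg _) (h (-s))

theorem IsSpectralInvPowers.norm_sandwich_le_of_nonneg [CompleteSpace H]
    (hP : IsSpectralInvPowers T R P)
    (hRA : ∀ u, R (A u) = A'.adjoint (R u)) (hT : IsNonnegPMap T)
    {z : ℂ} (hz : z ∈ verticalClosedStrip 0 1) (u : H) :
    ‖P z (A (P (1 - z) u))‖ ≤ ‖A‖ ^ (1 - z.re) * ‖A'‖ ^ z.re * ‖R u‖ := by
  have hlim : Tendsto (fun k : ℝ => Real.exp (k * z.im ^ 2 + k * (z.re * (1 - z.re))) *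
      (‖A‖ ^ (1 - z.re) * ‖A'‖ ^ z.re) * ‖R u‖) (𝓝[>] 0)
      (𝓝 (‖A‖ ^ (1 - z.re) * ‖A'‖ ^ z.re * ‖R u‖)) := by
    refine Tendsto.mono_left ?_ nhdsWithin_le_nhds
    refine Continuous.tendsto' (by fun_prop) _ _ (by simp)
  refine ge_of_tendsto hlim ?_
  filter_upwards [self_mem_nhdsWithin] with k hk
  simpa using hP.norm_sandwich_le hRA (hP.norm_imaginary_mul_le_of_nonneg hT) hk hz u

end SpectralPowers

section Inverse

variable {H : Type*} [NormedAddCommGroup H] [InnerProductSpace ℂ H] [CompleteSpace H]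
  {T S : H →ₗ.[ℂ] H} {R A A' B Q Q' : H →L[ℂ] H}

theorem IsBoundedInverse.inner_comm (hR : IsBoundedInverse T R) (hT : IsSelfAdjoint T) (x y : H) :
    ⟪R x, y⟫_ℂ = ⟪x, R y⟫_ℂ := by
  obtain ⟨hx, hx'⟩ := hR.2 x
  obtain ⟨hy, hy'⟩ := hR.2 y
  have h := LinearPMap.adjoint_isFormalAdjoint hT.dense_domain
  rw [LinearPMap.isSelfAdjoint_def.mp hT] at h
  have := h ⟨R x, hx⟩ ⟨R y, hy⟩
  rw [hx', hy'] at this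
  exact this.symm

theorem IsComposition.inner_adjoint (hS : Dense (S.domain : Set H)) (hA : IsComposition S R A)
    (hA' : IsComposition S.adjoint R A') (u v : H) : ⟪A' v, R u⟫_ℂ = ⟪R v, A u⟫_ℂ := by
  obtain ⟨hu, hu'⟩ := hA u
  obtain ⟨hv, hv'⟩ := hA' v
  rw [← hu', ← hv']
  exact LinearPMap.adjoint_isFormalAdjoint hS ⟨R v, hv⟩ ⟨R u, hu⟩

theorem IsBoundedInverse.comp_eq_adjoint_comp (hR : IsBoundedInverse T R) (hT : IsSelfAdjoint T)
    (hS : Dense (S.domain : Set H)) (hA : IsComposition S R A)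
    (hA' : IsComposition S.adjoint R A') (u : H) : R (A u) = A'.adjoint (R u) := by
  refine ext_inner_left ℂ fun y => ?_
  rw [ContinuousLinearMap.adjoint_inner_right, ← hR.inner_comm hT, hA.inner_adjoint hS hA']

theorem IsBoundedInverse.adjoint_commute (hR : IsBoundedInverse T R) (hT : IsSelfAdjoint T)
    (hQ : ∀ u, Q (R u) = R (Q u)) (v : H) : Q.adjoint (R v) = R (Q.adjoint v) := by
  refine ext_inner_right ℂ fun y => ?_
  rw [ContinuousLinearMap.adjoint_inner_left, hR.inner_comm hT, ← hQ, hR.inner_comm hT,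
    ContinuousLinearMap.adjoint_inner_left]

/-- A bounded operator agreeing with `Q S Q'` on `dom T` extends the maximally defined `Q S Q'`. -/
theorem extendsTo_of_eq_on_range (hR : IsBoundedInverse T R) (hT : IsSelfAdjoint T)
    (hS : Dense (S.domain : Set H)) (hdense : DenseRange R) (hA : IsComposition S R A)
    (hA' : IsComposition S.adjoint R A') (hQ : ∀ u, Q (R u) = R (Q u))
    (hQ' : ∀ u, Q' (R u) = R (Q' u)) (hB : ∀ u, B (R u) = Q (A (Q' u))) :
    ExtendsTo (LinearMap.compPMap (Q : H →ₗ[ℂ] H) (mcomp S ((Q' : H →ₗ[ℂ] H).toPMap ⊤))) B := by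
  rintro ⟨x, hx⟩
  have hxS : Q' x ∈ S.domain := (mem_mcompDomain.mp hx).2
  change Q (S ⟨Q' x, hxS⟩) = B x
  have hadj : ∀ v, Q'.adjoint (A' (Q.adjoint v)) = B.adjoint (R v) := fun v => by
    refine hdense.eq_of_inner_left ℂ fun u => ?_
    rw [ContinuousLinearMap.adjoint_inner_left, ContinuousLinearMap.adjoint_inner_left, hQ',
      hA.inner_adjoint hS hA', ← hR.adjoint_commute hT hQ,
      ContinuousLinearMap.adjoint_inner_left, hB]
  refine hdense.eq_of_inner_right ℂ fun v => ?_
  obtain ⟨hv, hv'⟩ := hA' (Q.adjoint v)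
  rw [← ContinuousLinearMap.adjoint_inner_left B, ← hadj,
    ← ContinuousLinearMap.adjoint_inner_left Q, ContinuousLinearMap.adjoint_inner_left Q',
    hR.adjoint_commute hT hQ, ← hv']
  exact (LinearPMap.adjoint_isFormalAdjoint hS ⟨_, hv⟩ ⟨_, hxS⟩).symm

end Inverse

theorem ExtendsTo.isClosable {E F : Type*} [NormedAddCommGroup E] [InnerProductSpace ℂ E]
    [NormedAddCommGroup F] [InnerProductSpace ℂ F] {Y : E →ₗ.[ℂ] F} {B : E →L[ℂ] F}
    (h : ExtendsTo Y B) : Y.IsClosable := by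
  refine LinearPMap.isClosable_iff_exists_closed_extension.mpr
    ⟨(B : E →ₗ[ℂ] F).toPMap ⊤, ?_, fun x _ => trivial, ?_⟩
  · have hgraph : (((B : E →ₗ[ℂ] F).toPMap ⊤).graph : Set (E × F)) = {p | B p.1 = p.2} := by
      ext p
      simp [LinearPMap.mem_graph_iff]
    change _root_.IsClosed _
    rw [hgraph]
    exact isClosed_eq (B.continuous.comp continuous_fst) continuous_snd
  · rintro x ⟨y, _⟩ (rfl : (x : E) = y)
    exact h x

theorem norm_le_of_denseRange {H : Type*} [NormedAddCommGroup H] [NormedSpace ℂ H]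
    {R B : H →L[ℂ] H} (hR : DenseRange R) {C : ℝ} (hC : 0 ≤ C)
    (h : ∀ u, ‖B (R u)‖ ≤ C * ‖R u‖) : ‖B‖ ≤ C :=
  B.opNorm_le_bound hC fun x => hR.induction_on x (isClosed_le (by fun_prop) (by fun_prop)) h

/-- Optimization over `k` in the prefactor `exp (k * q + k⁻¹ * π ^ 2)`. -/
theorem le_exp_sqrt_mul {q b M : ℝ} (hq : 0 ≤ q)
    (h : ∀ k : ℝ, 0 < k → b ≤ Real.exp (k * q + k⁻¹ * Real.pi ^ 2) * M) :
    b ≤ Real.exp (2 * Real.pi * Real.sqrt q) * M := by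
  rcases hq.eq_or_lt with rfl | hq
  · have hlim : Filter.Tendsto (fun k : ℝ => Real.exp (k⁻¹ * Real.pi ^ 2) * M) Filter.atTop
        (nhds (Real.exp (0 * Real.pi ^ 2) * M)) :=
      ((Real.continuous_exp.tendsto _).comp (tendsto_inv_atTop_zero.mul_const _)).mul_const M
    refine (ge_of_tendsto hlim ?_).trans_eq (by simp)
    filter_upwards [Filter.eventually_gt_atTop 0] with k hk
    simpa using h k hk
  · have hs : 0 < Real.sqrt q := Real.sqrt_pos.mpr hq
    refine (h (Real.pi / Real.sqrt q) (div_pos Real.pi_pos hs)).trans_eq ?_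
    congr 2
    have hpi := Real.pi_pos.ne'
    nth_rewrite 2 [← Real.sq_sqrt hq.le]
    field_simp
    ring

end OpInterp

open OpInterp in
/-- Theorem 2.7, norm bounds.  Let `T` be self-adjoint with `T⁻¹ ∈ B(H)`
and `S` closed with `dom S ∩ dom S* ⊇ dom T`.  Then for every `z ∈ Σ̄` the operator
`T^{-z} S T^{-1+z}` (defined on `dom T`) is closable with bounded closure, and for every
`k > 0`:
`‖cl(T^{-z}ST^{-1+z})‖ ≤ e^{k|Im z|² + k Re z(1-Re z) + k⁻¹π²} ‖ST⁻¹‖^{1-Re z} ‖S*T⁻¹‖^{Re z}`,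
with the exponential prefactor replaceable by `1` if `T ≥ 0`; consequently, for `x ∈ [0,1]`,
`‖cl(T^{-x}ST^{-1+x})‖ ≤ e^{2π√(x(1-x))} ‖ST⁻¹‖^{1-x} ‖S*T⁻¹‖^{x}` (prefactor `1` if
`T ≥ 0`).  Here `P w = T^{-w}` (`Re w ≥ 0`) is the spectral-theorem power family of `T`. -/
theorem statement9
    {H : Type*} [NormedAddCommGroup H] [InnerProductSpace ℂ H] [CompleteSpace H]
    [TopologicalSpace.SeparableSpace H]
    (T S : H →ₗ.[ℂ] H) (Tinv STinv SstarTinv : H →L[ℂ] H) (P : ℂ → H →L[ℂ] H)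
    (hT : IsSelfAdjoint T) (hTinv : IsBoundedInverse T Tinv)
    (hP : IsSpectralInvPowers T Tinv P)
    (hS : S.IsClosed) (hdomS : T.domain ≤ S.domain) (hdomS' : T.domain ≤ S.adjoint.domain)
    (hSTinv : IsComposition S Tinv STinv)
    (hSstarTinv : IsComposition S.adjoint Tinv SstarTinv) :
    (∀ z ∈ closedStrip,
      -- `T^{-z}ST^{-1+z}` is defined on `dom T` and closable with bounded closure:
      T.domain ≤ (LinearMap.compPMap ((P z) : H →ₗ[ℂ] H)
          (mcomp S (((P (1 - z)) : H →ₗ[ℂ] H).toPMap ⊤))).domain ∧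
      (LinearMap.compPMap ((P z) : H →ₗ[ℂ] H)
          (mcomp S (((P (1 - z)) : H →ₗ[ℂ] H).toPMap ⊤))).IsClosable ∧
      (∃ B : H →L[ℂ] H, ExtendsTo (LinearMap.compPMap ((P z) : H →ₗ[ℂ] H)
          (mcomp S (((P (1 - z)) : H →ₗ[ℂ] H).toPMap ⊤))) B) ∧
      ∀ k : ℝ, 0 < k →
        ∀ B : H →L[ℂ] H,
          ExtendsTo (LinearMap.compPMap ((P z) : H →ₗ[ℂ] H)
            (mcomp S (((P (1 - z)) : H →ₗ[ℂ] H).toPMap ⊤))) B →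
          ‖B‖ ≤ Real.exp (k * z.im ^ 2 + k * (z.re * (1 - z.re)) + k⁻¹ * Real.pi ^ 2) *
              (‖STinv‖ ^ (1 - z.re) * ‖SstarTinv‖ ^ z.re) ∧
          (IsNonnegPMap T → ‖B‖ ≤ ‖STinv‖ ^ (1 - z.re) * ‖SstarTinv‖ ^ z.re)) ∧
    ∀ x ∈ Set.Icc (0 : ℝ) 1,
      ∀ B : H →L[ℂ] H,
        ExtendsTo (LinearMap.compPMap ((P (x : ℂ)) : H →ₗ[ℂ] H)
          (mcomp S (((P (1 - (x : ℂ))) : H →ₗ[ℂ] H).toPMap ⊤))) B →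
        ‖B‖ ≤ Real.exp (2 * Real.pi * Real.sqrt (x * (1 - x))) *
            (‖STinv‖ ^ (1 - x) * ‖SstarTinv‖ ^ x) ∧
        (IsNonnegPMap T → ‖B‖ ≤ ‖STinv‖ ^ (1 - x) * ‖SstarTinv‖ ^ x) := by
  have hdense : DenseRange Tinv :=
    hT.dense_domain.mono fun x hx => ⟨T ⟨x, hx⟩, hTinv.1 ⟨x, hx⟩⟩
  have hSd : Dense (S.domain : Set H) := hT.dense_domain.mono hdomS
  have hRA := hTinv.comp_eq_adjoint_comp hT hSd hSTinv hSstarTinv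
  have hre : ∀ z ∈ closedStrip, 0 ≤ (1 - z).re := fun z hz => by simpa using hz.2
  have hdom : ∀ z ∈ closedStrip, T.domain ≤ (LinearMap.compPMap ((P z) : H →ₗ[ℂ] H)
      (mcomp S (((P (1 - z)) : H →ₗ[ℂ] H).toPMap ⊤))).domain := fun z hz x hx =>
    mem_mcompDomain.mpr ⟨trivial, hdomS (hP.mapsTo_domain _ (hre z hz) x hx)⟩
  have heq : ∀ z ∈ closedStrip, ∀ B : H →L[ℂ] H,
      ExtendsTo (LinearMap.compPMap ((P z) : H →ₗ[ℂ] H)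
        (mcomp S (((P (1 - z)) : H →ₗ[ℂ] H).toPMap ⊤))) B →
      ∀ u, B (Tinv u) = P z (STinv (P (1 - z) u)) := by
    intro z hz B hB u
    obtain ⟨hu, -⟩ := hTinv.2 u
    obtain ⟨hw, hw'⟩ := hSTinv (P (1 - z) u)
    have hx := hB ⟨Tinv u, hdom z hz hu⟩
    rw [← hx, ← hw']
    change P z (S ⟨P (1 - z) (Tinv u), _⟩) = _
    congr 3
    exact hP.commute_inv (hre z hz) u
  have hbound : ∀ z ∈ closedStrip, ∀ k : ℝ, 0 < k → ∀ B : H →L[ℂ] H,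
      ExtendsTo (LinearMap.compPMap ((P z) : H →ₗ[ℂ] H)
        (mcomp S (((P (1 - z)) : H →ₗ[ℂ] H).toPMap ⊤))) B →
      ‖B‖ ≤ Real.exp (k * z.im ^ 2 + k * (z.re * (1 - z.re)) + k⁻¹ * Real.pi ^ 2) *
        (‖STinv‖ ^ (1 - z.re) * ‖SstarTinv‖ ^ z.re) := fun z hz k hk B hB =>
    norm_le_of_denseRange hdense (by positivity) fun u => by
      rw [heq z hz B hB]
      exact hP.norm_sandwich_le hRA hP.norm_imaginary_mul_le hk hz u
  have hbound_nonneg : IsNonnegPMap T → ∀ z ∈ closedStrip, ∀ B : H →L[ℂ] H,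
      ExtendsTo (LinearMap.compPMap ((P z) : H →ₗ[ℂ] H)
        (mcomp S (((P (1 - z)) : H →ₗ[ℂ] H).toPMap ⊤))) B →
      ‖B‖ ≤ ‖STinv‖ ^ (1 - z.re) * ‖SstarTinv‖ ^ z.re := fun hT₀ z hz B hB =>
    norm_le_of_denseRange hdense (by positivity) fun u => by
      rw [heq z hz B hB]
      exact hP.norm_sandwich_le_of_nonneg hRA hT₀ hz u
  refine ⟨fun z hz => ?_, fun x hx B hB => ?_⟩
  · have hnorm := hP.norm_sandwich_le hRA hP.norm_imaginary_mul_le one_pos hz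
    have hB : ExtendsTo (LinearMap.compPMap ((P z) : H →ₗ[ℂ] H)
        (mcomp S (((P (1 - z)) : H →ₗ[ℂ] H).toPMap ⊤)))
        (LinearMap.extendOfNorm ((P z ∘L STinv ∘L P (1 - z) : H →L[ℂ] H) : H →ₗ[ℂ] H)
          (Tinv : H →ₗ[ℂ] H)) :=
      extendsTo_of_eq_on_range hTinv hT hSd hdense hSTinv hSstarTinv
        (hP.commute_inv hz.1) (hP.commute_inv (hre z hz))
        (LinearMap.extendOfNorm_eq hdense ⟨_, hnorm⟩)
    exact ⟨hdom z hz, hB.isClosable, ⟨_, hB⟩, fun k hk B hB =>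
      ⟨hbound z hz k hk B hB, fun hT₀ => hbound_nonneg hT₀ z hz B hB⟩⟩
  · have hxs : (x : ℂ) ∈ closedStrip := by simpa [closedStrip] using hx
    refine ⟨?_, fun hT₀ => by simpa using hbound_nonneg hT₀ x hxs B hB⟩
    refine le_exp_sqrt_mul (mul_nonneg hx.1 (sub_nonneg.mpr hx.2)) fun k hk => ?_
    simpa using hbound x hxs k hk B hB
end
end
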